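/- Let G=(V,E) be a finite connected graph, let L be a laminar family of subsets of V, let c : E → ℝ≥0 be edge costs, let x be a point of the spanning tree polytope of G, and let η > 2 be a real number. Then there exists a spanning tree T of G such that Σ_{e∈T} c(e) ≤ η·Σ_{e∈E} c(e)·x(e), and for every S ∈ L, |T ∩ δ(S)| ≤ (1/(1−2/η))·(2η+3)·x(δ(S)). -/

import Mathlib

open scoped Classical
open Finset

noncomputable section

variable {V : Type}

/-- The set of edges of `G` with exactly one endpoint in `S`. -/
def cutEdges [Fintype V] (G : SimpleGraph V) (S : Set V) : Finset (Sym2 V) :=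
  Finset.univ.filter (fun e => e ∈ G.edgeSet ∧ ∃ u v, e = s(u, v) ∧ u ∈ S ∧ v ∉ S)

/-- The set of edges of `G` with both endpoints in `S`. -/
def insideEdges [Fintype V] (G : SimpleGraph V) (S : Set V) : Finset (Sym2 V) :=
  Finset.univ.filter (fun e => e ∈ G.edgeSet ∧ ∀ v ∈ e, v ∈ S)

/-- A family of sets is laminar if any two members are disjoint or nested. -/
def Laminar (L : Set (Set V)) : Prop :=
  ∀ S T, S ∈ L → T ∈ L → S ∩ T = ∅ ∨ S ∩ T = S ∨ S ∩ T = T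

/-- The spanning tree polytope of `G` : the convex hull of the indicator vectors of
the edge sets of spanning trees of `G`. -/
def stPolytope [Fintype V] (G : SimpleGraph V) : Set (Sym2 V → ℝ) :=
  convexHull ℝ { y | ∃ T : SimpleGraph V, T ≤ G ∧ T.IsTree ∧
      y = fun e => if e ∈ T.edgeSet then (1 : ℝ) else 0 }

/-- `x` is `L`-aligned: for every `S ∈ L`, the restriction of `x` to `E(S)` lies in the
spanning tree polytope of the induced subgraph `G[S]`. -/
def IsAligned [Fintype V] (G : SimpleGraph V) (L : Set (Set V)) (x : Sym2 V → ℝ) : Prop :=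
  ∀ S ∈ L, (fun e : Sym2 S => x (e.map Subtype.val)) ∈ stPolytope (G.induce S)

/-- Edges with at least one endpoint in `S`. -/
def touchEdges [Fintype V] (S : Finset V) : Finset (Sym2 V) :=
  univ.filter fun e => ∃ u ∈ e, u ∈ S

/-- Pairs with exactly one endpoint in `S`. -/
def crossEdges [Fintype V] (S : Finset V) : Finset (Sym2 V) :=
  univ.filter fun e => (∃ u ∈ e, u ∈ S) ∧ ∃ v ∈ e, v ∉ S

/-- The inequalities defining the forest polytope of the complete graph. -/
def ForestPoint (z : Sym2 V → ℝ) : Prop :=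
  (∀ e, 0 ≤ z e) ∧ ∀ U : Finset V, U.Nonempty → ∑ e ∈ U.sym2, z e ≤ U.card - 1

/-- A vertex set on which `z` attains the forest bound. -/
def Tight (z : Sym2 V → ℝ) (U : Finset V) : Prop :=
  U.Nonempty ∧ ∑ e ∈ U.sym2, z e = U.card - 1

/-- A laminar family of finite sets: any two members are disjoint or comparable. -/
def FLaminar (H : Finset (Finset V)) : Prop :=
  ∀ A ∈ H, ∀ B ∈ H, Disjoint A B ∨ A ⊆ B ∨ B ⊆ A

lemma sum_le_sum_of_subset' {z : Sym2 V → ℝ} (hz : ∀ e, 0 ≤ z e) {A B : Finset (Sym2 V)}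
    (h : A ⊆ B) : ∑ e ∈ A, z e ≤ ∑ e ∈ B, z e :=
  sum_le_sum_of_subset_of_nonneg h fun e _ _ => hz e

lemma sym2_inter_eq (U W : Finset V) : U.sym2 ∩ W.sym2 = (U ∩ W).sym2 := by
  ext e
  simp only [mem_inter, mem_sym2_iff]
  grind

lemma tight_inter_union {z : Sym2 V → ℝ} (hz : ForestPoint z) {U W : Finset V}
    (hU : Tight z U) (hW : Tight z W) (hne : (U ∩ W).Nonempty) :
    Tight z (U ∩ W) ∧ Tight z (U ∪ W) ∧
      ∀ e ∈ (U ∪ W).sym2, e ∉ U.sym2 → e ∉ W.sym2 → z e = 0 := by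
  have h1 := sum_union_inter (s₁ := U.sym2) (s₂ := W.sym2) (f := z)
  rw [sym2_inter_eq] at h1
  have hsub : U.sym2 ∪ W.sym2 ⊆ (U ∪ W).sym2 :=
    union_subset (sym2_mono subset_union_left) (sym2_mono subset_union_right)
  have h2 := sum_sdiff (f := z) hsub
  have h3 : 0 ≤ ∑ e ∈ (U ∪ W).sym2 \ (U.sym2 ∪ W.sym2), z e := sum_nonneg fun e _ => hz.1 e
  have h4 := hz.2 _ hne
  have hne' : (U ∪ W).Nonempty := hU.1.mono subset_union_left
  have h5 := hz.2 _ hne'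
  have h6 : ((U ∪ W).card : ℝ) + (U ∩ W).card = U.card + W.card := by
    exact_mod_cast card_union_add_card_inter U W
  have hU2 := hU.2
  have hW2 := hW.2
  refine ⟨⟨hne, by linarith⟩, ⟨hne', by linarith⟩, fun e he heU heW => ?_⟩
  have h7 : ∑ e ∈ (U ∪ W).sym2 \ (U.sym2 ∪ W.sym2), z e = 0 := by linarith
  exact (sum_eq_zero_iff_of_nonneg fun e _ => hz.1 e).1 h7 e (by simp [he, heU, heW])

lemma not_tight_of_split [Fintype V] {z : Sym2 V → ℝ} (hz : ForestPoint z) {D S : Finset V}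
    (h0 : ∀ e ∈ D.sym2, e ∈ crossEdges S → z e = 0) (h1 : (D ∩ S).Nonempty)
    (h2 : (D \ S).Nonempty) : ¬ Tight z D := by
  intro hD
  have hle : ∑ e ∈ D.sym2, z e ≤ ∑ e ∈ (D ∩ S).sym2, z e + ∑ e ∈ (D \ S).sym2, z e := by
    rw [← sum_union_inter]
    have : ∑ e ∈ D.sym2, z e ≤ ∑ e ∈ (D ∩ S).sym2 ∪ (D \ S).sym2, z e := by
      rw [← sum_filter_add_sum_filter_not D.sym2 (fun e => e ∈ crossEdges S)]
      rw [sum_eq_zero (s := D.sym2.filter _) (fun e he => h0 e (mem_filter.1 he).1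
        (mem_filter.1 he).2), zero_add]
      refine sum_le_sum_of_subset' hz.1 fun e he => ?_
      simp only [mem_filter, mem_sym2_iff, crossEdges, mem_univ, true_and, mem_union, mem_inter,
        mem_sdiff] at he ⊢
      grind
    have h3 : 0 ≤ ∑ e ∈ (D ∩ S).sym2 ∩ (D \ S).sym2, z e := sum_nonneg fun e _ => hz.1 e
    linarith
  have h3 := hz.2 _ h1
  have h4 := hz.2 _ h2
  have h5 : ((D \ S).card : ℝ) + (D ∩ S).card = D.card := by
    exact_mod_cast card_sdiff_add_card_inter D S
  have := hD.2
  linarith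

lemma touchEdges_sum [Fintype V] (y : Sym2 V → ℝ) (S : Finset V) :
    ∑ e ∈ touchEdges S, y e = ∑ e ∈ crossEdges S, y e + ∑ e ∈ S.sym2, y e := by
  rw [← sum_union]
  · congr 1
    ext e
    simp only [touchEdges, crossEdges, mem_union, mem_filter, mem_univ, true_and, mem_sym2_iff]
    induction e with | _ a b => simp; grind
  · rw [disjoint_left]
    intro e
    simp only [crossEdges, mem_filter, mem_univ, true_and, mem_sym2_iff]
    grind

lemma tight_singleton {z : Sym2 V → ℝ} (hz : ForestPoint z) (v : V) : Tight z {v} := by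
  refine ⟨singleton_nonempty v, le_antisymm (hz.2 _ (singleton_nonempty v)) ?_⟩
  simpa using sum_nonneg fun e (_ : e ∈ ({v} : Finset V).sym2) => hz.1 e

lemma ForestPoint.le_one {z : Sym2 V → ℝ} (hz : ForestPoint z) (e : Sym2 V) : z e ≤ 1 := by
  induction e with | _ a b =>
  have h := hz.2 {a, b} (by simp)
  have h2 : z s(a, b) ≤ ∑ e ∈ ({a, b} : Finset V).sym2, z e :=
    single_le_sum (fun e _ => hz.1 e) (by simp)
  have h3 : (({a, b} : Finset V).card : ℝ) ≤ 2 := by exact_mod_cast card_le_two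
  linarith

/-- A point of a finite system of weak linear inequalities can be moved a little in any direction
along which the active inequalities do not increase. -/
lemma exists_pos_step {ι : Type*} [Finite ι] (a b β : ι → ℝ) (h : ∀ i, a i ≤ β i)
    (hb : ∀ i, a i = β i → b i ≤ 0) : ∃ ε : ℝ, 0 < ε ∧ ∀ i, a i + ε * b i ≤ β i := by
  have : ∀ i, ∀ᶠ ε in nhdsWithin (0 : ℝ) (Set.Ioi 0), a i + ε * b i ≤ β i := by
    intro i
    rcases (h i).lt_or_eq with hlt | heq
    · have hc : Filter.Tendsto (fun ε : ℝ => a i + ε * b i) (nhdsWithin 0 (Set.Ioi 0))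
          (nhds (a i + 0 * b i)) :=
        (Continuous.tendsto (by fun_prop) 0).mono_left nhdsWithin_le_nhds
      have := hc.eventually (gt_mem_nhds (show a i + 0 * b i < β i by simpa using hlt))
      exact this.mono fun ε hε => hε.le
    · filter_upwards [self_mem_nhdsWithin] with ε hε
      have := mul_nonpos_of_nonneg_of_nonpos (le_of_lt hε) (hb i heq)
      linarith
  obtain ⟨ε, h1, h2⟩ := ((Filter.eventually_all.2 this).and self_mem_nhdsWithin).exists
  exact ⟨ε, h2, h1⟩

/-- Neither disjoint nor comparable. -/
def Crosses (A B : Finset V) : Prop := ¬ (Disjoint A B ∨ A ⊆ B ∨ B ⊆ A)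

lemma crosses_of_crosses_inter {K H U : Finset V} (hKH : ¬ Crosses K H)
    (h : Crosses K (U ∩ H)) : Crosses K U := by
  simp only [Crosses, not_or, disjoint_left] at *
  grind

lemma crosses_of_crosses_union {K H U : Finset V} (hKH : ¬ Crosses K H) (hUH : Crosses H U)
    (h : Crosses K (U ∪ H)) : Crosses K U := by
  simp only [Crosses, not_or, disjoint_left] at *
  grind

lemma sum_sym2_uncross {z : Sym2 V → ℝ} (hz : ForestPoint z) {U W : Finset V}
    (hU : Tight z U) (hW : Tight z W) (hne : (U ∩ W).Nonempty) {y : Sym2 V → ℝ}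
    (hy : ∀ e, z e = 0 → y e = 0) :
    ∑ e ∈ U.sym2, y e + ∑ e ∈ W.sym2, y e =
      ∑ e ∈ (U ∪ W).sym2, y e + ∑ e ∈ (U ∩ W).sym2, y e := by
  rw [← sum_union_inter, sym2_inter_eq]
  congr 1
  refine sum_subset (union_subset (sym2_mono subset_union_left) (sym2_mono subset_union_right))
    fun e he hne' => hy e ?_
  rw [mem_union, not_or] at hne'
  exact (tight_inter_union hz hU hW hne).2.2 e he hne'.1 hne'.2

lemma exists_laminar_spanning [Fintype V] {z : Sym2 V → ℝ} (hz : ForestPoint z)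
    {L : Finset (Finset V)} (hL : FLaminar L) (hLt : ∀ S ∈ L, Tight z S) :
    ∃ H : Finset (Finset V), L ⊆ H ∧ FLaminar H ∧ (∀ S ∈ H, Tight z S) ∧
      ∀ y : Sym2 V → ℝ, (∀ e, z e = 0 → y e = 0) → (∀ S ∈ H, ∑ e ∈ S.sym2, y e = 0) →
        ∀ U, Tight z U → ∑ e ∈ U.sym2, y e = 0 := by
  obtain ⟨H, hLH, hH⟩ := exists_le_maximal
    (univ.filter fun H : Finset (Finset V) => FLaminar H ∧ ∀ S ∈ H, Tight z S)
    (a := L) (by simp [hL]; exact hLt)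
  have hH1 := hH.1
  simp only [mem_filter, mem_univ, true_and] at hH1
  obtain ⟨hlam, ht⟩ := hH1
  refine ⟨H, hLH, hlam, ht, fun y hy hyH U => ?_⟩
  induction hn : (H.filter fun K => Crosses K U).card using Nat.strong_induction_on
    generalizing U with
  | _ n ih =>
  intro hU
  by_cases hc : ∃ K ∈ H, Crosses K U
  · obtain ⟨K, hK, hKU⟩ := hc
    have hne : (U ∩ K).Nonempty := by
      simp only [Crosses, not_or, not_disjoint_iff] at hKU
      obtain ⟨⟨a, ha, hb⟩, -⟩ := hKU
      exact ⟨a, by simp [ha, hb]⟩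
    have hlt : ∀ W, (∀ K' ∈ H, Crosses K' W → Crosses K' U) → ¬ Crosses K W →
        (H.filter fun K' => Crosses K' W).card < n := by
      intro W hW hKW
      rw [← hn]
      refine card_lt_card ⟨fun K' hK' => ?_, fun hsub => ?_⟩
      · rw [mem_filter] at hK' ⊢
        exact ⟨hK'.1, hW _ hK'.1 hK'.2⟩
      · exact hKW (mem_filter.1 (hsub (mem_filter.2 ⟨hK, hKU⟩))).2
    have hnc : ∀ K' ∈ H, ¬ Crosses K' K := fun K' hK' => not_not.2 (hlam K' hK' K hK)
    obtain ⟨t1, t2, -⟩ := tight_inter_union hz hU (ht K hK) hne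
    have e1 := ih _ (hlt (U ∩ K) (fun K' hK' => crosses_of_crosses_inter (hnc K' hK'))
      (not_not.2 (.inr (.inr inter_subset_right)))) _ rfl t1
    have e2 := ih _ (hlt (U ∪ K) (fun K' hK' => crosses_of_crosses_union (hnc K' hK') hKU)
      (not_not.2 (.inr (.inl subset_union_right)))) _ rfl t2
    have := sum_sym2_uncross hz hU (ht K hK) hne hy
    rw [e1, e2, hyH K hK] at this
    linarith
  · push Not at hc
    refine hyH U ?_
    refine hH.2 (y := insert U H) ?_ (subset_insert U H) (mem_insert_self U H)
    simp only [mem_filter, mem_univ, true_and]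
    have hc' : ∀ K ∈ H, Disjoint K U ∨ K ⊆ U ∨ U ⊆ K := fun K hK => not_not.1 (hc K hK)
    refine ⟨fun A hA B hB => ?_, fun S hS => ?_⟩
    · rw [mem_insert] at hA hB
      rcases hA with rfl | hA <;> rcases hB with rfl | hB
      · exact .inr (.inl subset_rfl)
      · have := hc' B hB
        rw [disjoint_comm]; tauto
      · exact hc' A hA
      · exact hlam A hA B hB
    · rw [mem_insert] at hS
      rcases hS with rfl | hS
      · exact hU
      · exact ht S hS

/-- Branching nodes of a laminar family over a finite set of points. -/
lemma card_branching_lt {H : Finset (Finset V)} (hH : FLaminar H) {X : Finset V}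
    (hX : X.Nonempty)
    (hb : ∀ A ∈ H, ∃ a ∈ X, ∃ b ∈ X, a ≠ b ∧ a ∈ A ∧ b ∈ A ∧
      ∀ B ∈ H, a ∈ B → b ∈ B → A ⊆ B) : H.card + 1 ≤ X.card := by
  induction hn : H.card generalizing H X with
  | zero => exact hX.card_pos
  | succ n ih =>
  obtain ⟨A, hA⟩ := exists_minimal (card_pos.1 (by omega : 0 < H.card))
  obtain ⟨a, haX, b, hbX, hab, haA, hbA, -⟩ := hb A hA.1
  have hmin : ∀ B ∈ H, B ⊆ A → B = A := fun B hB h => subset_antisymm h (hA.2 hB h)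
  have key : ∀ C ∈ H, C ≠ A → ∀ d ∈ X, d ≠ a → a ∈ C → d ∈ C →
      (∀ B ∈ H, a ∈ B → d ∈ B → C ⊆ B) →
      d ≠ b ∧ b ∈ C ∧ ∀ B ∈ H, B ≠ A → b ∈ B → d ∈ B → C ⊆ B := by
    intro C hC hCA d hd hda haC hdC hCB
    have hdb : d ≠ b := by
      rintro rfl
      exact hCA (hmin C hC (hCB A hA.1 haA hbA))
    have hAC : A ⊆ C := by
      rcases hH A hA.1 C hC with h | h | h
      · exact absurd haC (disjoint_left.1 h haA)
      · exact h
      · exact absurd (hmin C hC h) hCA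
    refine ⟨hdb, hAC hbA, fun B hB hBA hbB hdB => hCB B hB ?_ hdB⟩
    rcases hH A hA.1 B hB with h | h | h
    · exact absurd hbB (disjoint_left.1 h hbA)
    · exact h haA
    · exact absurd (hmin B hB h) hBA
  have := ih (H := H.erase A) (X := X.erase a)
    (fun B hB C hC => hH B (mem_of_mem_erase hB) C (mem_of_mem_erase hC))
    ⟨b, mem_erase.2 ⟨hab.symm, hbX⟩⟩ ?_ (by rw [card_erase_of_mem hA.1]; omega)
  · rw [card_erase_of_mem haX] at this
    have := card_pos.2 ⟨a, haX⟩
    omega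
  · intro C hC
    rw [mem_erase] at hC
    obtain ⟨c, hc, d, hd, hcd, hcC, hdC, hmn⟩ := hb C hC.2
    have hba : b ∈ X.erase a := mem_erase.2 ⟨hab.symm, hbX⟩
    by_cases hca : c = a
    · subst hca
      obtain ⟨k1, k2, k3⟩ := key C hC.2 hC.1 d hd hcd.symm hcC hdC hmn
      refine ⟨b, hba, d, mem_erase.2 ⟨hcd.symm, hd⟩, k1.symm, k2, hdC, fun B hB => ?_⟩
      rw [mem_erase] at hB
      exact k3 B hB.2 hB.1
    · by_cases hda : d = a
      · subst hda
        obtain ⟨k1, k2, k3⟩ := key C hC.2 hC.1 c hc hca hdC hcC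
          (fun B hB h1 h2 => hmn B hB h2 h1)
        refine ⟨c, mem_erase.2 ⟨hca, hc⟩, b, hba, k1, hcC, k2, fun B hB h1 h2 => ?_⟩
        rw [mem_erase] at hB
        exact k3 B hB.2 hB.1 h2 h1
      · exact ⟨c, mem_erase.2 ⟨hca, hc⟩, d, mem_erase.2 ⟨hda, hd⟩, hcd, hcC, hdC,
          fun B hB => hmn B (mem_of_mem_erase hB)⟩

lemma exists_least_containing {H : Finset (Finset V)} (hH : FLaminar H) {e : Sym2 V}
    (he : ∃ A ∈ H, e ∈ A.sym2) :
    ∃ A ∈ H, e ∈ A.sym2 ∧ ∀ B ∈ H, e ∈ B.sym2 → A ⊆ B := by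
  obtain ⟨A, hA, heA⟩ := he
  obtain ⟨M, hM⟩ := exists_minimal (s := H.filter fun A => e ∈ A.sym2)
    ⟨A, mem_filter.2 ⟨hA, heA⟩⟩
  have hM1 := mem_filter.1 hM.1
  refine ⟨M, hM1.1, hM1.2, fun B hB heB => ?_⟩
  rcases hH M hM1.1 B hB with h | h | h
  · exfalso
    rw [mem_sym2_iff] at heB
    have := mem_sym2_iff.1 hM1.2
    induction e with | _ a b =>
    exact disjoint_left.1 h (this a (by simp)) (heB a (by simp))
  · exact h
  · exact hM.2 (mem_filter.2 ⟨hB, heB⟩) h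

lemma card_frac_ne_one {ι : Type*} {f : ι → ℝ} (h0 : ∀ i, 0 ≤ f i) (h1 : ∀ i, f i ≤ 1)
    {A : Finset ι} (hA : ∃ n : ℤ, ∑ i ∈ A, f i = n) :
    (A.filter fun i => 0 < f i ∧ f i < 1).card ≠ 1 := by
  intro h
  obtain ⟨a, ha⟩ := card_eq_one.1 h
  obtain ⟨n, hn⟩ := hA
  have h2 := sum_filter_add_sum_filter_not A (fun i => 0 < f i ∧ f i < 1) f
  have h3 : ∑ i ∈ A.filter (fun i => ¬ (0 < f i ∧ f i < 1)), f i =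
      ((∑ i ∈ A.filter (fun i => ¬ (0 < f i ∧ f i < 1)), if f i = 0 then 0 else 1 : ℤ) : ℝ) := by
    push_cast
    refine sum_congr rfl fun i hi => ?_
    have := (mem_filter.1 hi).2
    split_ifs with h4
    · exact h4
    · exact le_antisymm (h1 i) (not_lt.1 fun h5 => this ⟨lt_of_le_of_ne (h0 i) (Ne.symm h4), h5⟩)
  have ha2 : a ∈ A.filter fun i => 0 < f i ∧ f i < 1 := by rw [ha]; simp
  obtain ⟨-, ha3, ha4⟩ := mem_filter.1 ha2
  rw [ha, sum_singleton, h3, hn] at h2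
  generalize (∑ i ∈ A.filter (fun i => ¬ (0 < f i ∧ f i < 1)), if f i = 0 then 0 else 1 : ℤ) = k
    at h2
  have h5 : f a = ((n - k : ℤ) : ℝ) := by push_cast; linarith
  rw [h5] at ha3 ha4
  norm_cast at ha3 ha4
  omega

lemma card_le_of_sums_determine {α : Type*} [Fintype α] (F : Finset α) (I : Finset (Finset α))
    (h : ∀ y : α → ℝ, (∀ e, e ∉ F → y e = 0) → (∀ A ∈ I, ∑ e ∈ A, y e = 0) → y = 0) :
    F.card ≤ I.card := by
  let ext : (F → ℝ) →ₗ[ℝ] (α → ℝ) :=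
    { toFun := fun g e => if he : e ∈ F then g ⟨e, he⟩ else 0
      map_add' := fun g g' => by ext e; by_cases he : e ∈ F <;> simp [he]
      map_smul' := fun r g => by ext e; by_cases he : e ∈ F <;> simp [he] }
  let φ : (F → ℝ) →ₗ[ℝ] (I → ℝ) :=
    { toFun := fun g A => ∑ e ∈ A.1, ext g e
      map_add' := fun g g' => by ext A; simp [sum_add_distrib]
      map_smul' := fun r g => by ext A; simp [mul_sum] }
  have hφ : Function.Injective φ := by
    rw [← LinearMap.ker_eq_bot, LinearMap.ker_eq_bot']
    intro g hg
    have h0 := h (ext g) (fun e he => dif_neg he) fun A hA => congrFun hg ⟨A, hA⟩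
    ext ⟨e, he⟩
    have := congrFun h0 e
    simpa [ext, he] using this
  simpa using LinearMap.finrank_le_finrank_of_injective hφ

lemma sum_sym2_eq_sum_fibers [Fintype V] {H : Finset (Finset V)} {hm : Sym2 V → Finset V}
    (hmH : ∀ e, hm e ∈ H) (hme : ∀ e, e ∈ (hm e).sym2)
    (hml : ∀ e, ∀ B ∈ H, e ∈ B.sym2 → hm e ⊆ B) (y : Sym2 V → ℝ) {A : Finset V} (hA : A ∈ H) :
    ∑ e ∈ A.sym2, y e =
      ∑ B ∈ H.filter (· ⊆ A), ∑ e ∈ univ.filter (fun e => hm e = B), y e := by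
  have : A.sym2 = univ.filter fun e => hm e ⊆ A := by
    ext e
    simp only [mem_filter, mem_univ, true_and]
    exact ⟨hml e A hA, fun h => sym2_mono h (hme e)⟩
  rw [this, ← sum_fiberwise_of_maps_to (t := H.filter (· ⊆ A)) (g := hm)]
  · refine sum_congr rfl fun B hB => sum_congr ?_ fun _ _ => rfl
    ext e
    simp only [mem_filter, mem_univ, true_and] at hB ⊢
    exact ⟨fun h => h.2, fun h => ⟨h ▸ hB.2, h⟩⟩
  · intro e he
    exact mem_filter.2 ⟨hmH e, (mem_filter.1 he).2⟩

lemma sum_fiber_int [Fintype V] {z : Sym2 V → ℝ} {H : Finset (Finset V)}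
    (hHt : ∀ A ∈ H, Tight z A) {hm : Sym2 V → Finset V}
    (hmH : ∀ e, hm e ∈ H) (hme : ∀ e, e ∈ (hm e).sym2)
    (hml : ∀ e, ∀ B ∈ H, e ∈ B.sym2 → hm e ⊆ B) {A : Finset V} (hA : A ∈ H) :
    ∃ n : ℤ, ∑ e ∈ univ.filter (fun e => hm e = A), z e = n := by
  induction A using Finset.strongInduction with | H A ih =>
  have h1 := sum_sym2_eq_sum_fibers hmH hme hml z hA
  rw [(hHt A hA).2, ← add_sum_erase (H.filter (· ⊆ A)) _ (mem_filter.2 ⟨hA, Subset.refl A⟩)] at h1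
  have h2 : ∀ B : Finset V, ∃ n : ℤ, B ∈ (H.filter (· ⊆ A)).erase A →
      ∑ e ∈ univ.filter (fun e => hm e = B), z e = n := by
    intro B
    by_cases hB : B ∈ (H.filter (· ⊆ A)).erase A
    · rw [mem_erase, mem_filter] at hB
      obtain ⟨n, hn⟩ := ih B (Finset.ssubset_iff_subset_ne.2 ⟨hB.2.2, hB.1⟩) hB.2.1
      exact ⟨n, fun _ => hn⟩
    · exact ⟨0, fun h => absurd h hB⟩
  choose n hn using h2
  rw [sum_congr rfl hn] at h1
  refine ⟨A.card - 1 - ∑ B ∈ (H.filter (· ⊆ A)).erase A, n B, ?_⟩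
  push_cast
  linarith

/-- The pairs touching two disjoint members of `M`. -/
def linkEdges [Fintype V] (M : Finset (Finset V)) : Finset (Sym2 V) :=
  univ.filter fun e => ∃ Q ∈ M, ∃ Q' ∈ M, Disjoint Q Q' ∧ e ∈ touchEdges Q ∧ e ∈ touchEdges Q'

/-- The pairs touching `R` but no smaller member of `M`. -/
def lowEdges [Fintype V] (M : Finset (Finset V)) (R : Finset V) : Finset (Sym2 V) :=
  univ.filter fun e => e ∈ touchEdges R ∧ ∀ Q ∈ M, Q ⊂ R → e ∉ touchEdges Q

lemma card_le_two_of_touch [Fintype V] {N : Finset (Finset V)}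
    (hN : ∀ A ∈ N, ∀ B ∈ N, A ≠ B → Disjoint A B) {e : Sym2 V}
    (he : ∀ A ∈ N, e ∈ touchEdges A) : N.card ≤ 2 := by
  by_contra! hlt
  obtain ⟨A, hA, B, hB, C, hC, hAB, hAC, hBC⟩ := two_lt_card.1 hlt
  have d1 := disjoint_left.1 (hN A hA B hB hAB)
  have d2 := disjoint_left.1 (hN A hA C hC hAC)
  have d3 := disjoint_left.1 (hN B hB C hC hBC)
  have t1 := he A hA
  have t2 := he B hB
  have t3 := he C hC
  simp only [touchEdges, mem_filter, mem_univ, true_and] at t1 t2 t3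
  induction e with | _ u v =>
  simp only [Sym2.mem_iff] at t1 t2 t3
  clear hN he
  grind

lemma sum_card_lowEdges_le [Fintype V] {M : Finset (Finset V)} (hM : FLaminar M)
    (F : Finset (Sym2 V)) :
    ∑ R ∈ M, (F ∩ lowEdges M R).card ≤ F.card + (F ∩ linkEdges M).card := by
  have h1 : ∀ R, (F ∩ lowEdges M R).card = ∑ e ∈ F, if e ∈ lowEdges M R then 1 else 0 := by
    intro R
    rw [← filter_mem_eq_inter, card_filter]
  have h2 : (F ∩ linkEdges M).card = ∑ e ∈ F, if e ∈ linkEdges M then 1 else 0 := by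
    rw [← filter_mem_eq_inter, card_filter]
  simp_rw [h1]
  rw [sum_comm, h2, card_eq_sum_ones, ← sum_add_distrib]
  refine sum_le_sum fun e _ => ?_
  rw [← card_filter]
  have hdis : ∀ R ∈ M, ∀ R' ∈ M, e ∈ lowEdges M R → e ∈ lowEdges M R' → R ≠ R' →
      Disjoint R R' := by
    intro R hR R' hR' hl hl' hne
    simp only [lowEdges, mem_filter, mem_univ, true_and] at hl hl'
    rcases hM R hR R' hR' with h | h | h
    · exact h
    · exact absurd hl.1 (hl'.2 R hR (Finset.ssubset_iff_subset_ne.2 ⟨h, hne⟩))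
    · exact absurd hl'.1 (hl.2 R' hR' (Finset.ssubset_iff_subset_ne.2 ⟨h, hne.symm⟩))
  have htouch : ∀ R, e ∈ lowEdges M R → e ∈ touchEdges R := fun R h => (mem_filter.1 h).2.1
  split_ifs with hlink
  · refine card_le_two_of_touch (fun A hA B hB => ?_) fun A hA => htouch A (mem_filter.1 hA).2
    exact hdis A (mem_filter.1 hA).1 B (mem_filter.1 hB).1 (mem_filter.1 hA).2 (mem_filter.1 hB).2
  · rw [add_zero, card_le_one]
    intro A hA B hB
    rw [mem_filter] at hA hB
    by_contra hne
    exact hlink (mem_filter.2 ⟨mem_univ _, A, hA.1, B, hB.1, hdis A hA.1 B hB.1 hA.2 hB.2 hne,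
      htouch A hA.2, htouch B hB.2⟩)
/-- `R` is the least member of `M` containing two suitable points of `X`. -/
def Branching (M : Finset (Finset V)) (X R : Finset V) : Prop :=
  ∃ a ∈ X, ∃ b ∈ X, a ≠ b ∧ a ∈ R ∧ b ∈ R ∧ ∀ B ∈ M, a ∈ B → b ∈ B → R ⊆ B

lemma exists_leaf_subset {M : Finset (Finset V)} {Q : Finset V} (hQ : Q ∈ M) :
    ∃ R ∈ M.filter (fun R => ∀ Q ∈ M, ¬ Q ⊂ R), R ⊆ Q := by
  obtain ⟨R, hR⟩ := exists_minimal (s := M.filter (· ⊆ Q)) ⟨Q, mem_filter.2 ⟨hQ, Subset.refl Q⟩⟩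
  have hR1 := mem_filter.1 hR.1
  refine ⟨R, mem_filter.2 ⟨hR1.1, fun Q' hQ' hlt => ?_⟩, hR1.2⟩
  exact hlt.2 (hR.2 (mem_filter.2 ⟨hQ', hlt.1.trans hR1.2⟩) hlt.1)

/-- A transversal of the minimal members of a laminar family. -/
lemma exists_leaf_points {M : Finset (Finset V)} (hM : FLaminar M)
    (hne : ∀ R ∈ M, R.Nonempty) :
    ∃ X : Finset V, X.card = (M.filter fun R => ∀ Q ∈ M, ¬ Q ⊂ R).card ∧
      ∀ R ∈ M, (X ∩ R).Nonempty := by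
  have : ∀ R : Finset V, ∃ v : Option V, R ∈ M → ∃ a, v = some a ∧ a ∈ R := by
    intro R
    by_cases hR : R ∈ M
    · obtain ⟨a, ha⟩ := hne R hR
      exact ⟨some a, fun _ => ⟨a, rfl, ha⟩⟩
    · exact ⟨none, fun h => absurd h hR⟩
  choose p hp using this
  have hmem : ∀ R ∈ M, ∀ a, p R = some a → a ∈ R := by
    intro R hR a ha
    obtain ⟨b, hb, hbR⟩ := hp R hR
    rw [ha, Option.some.injEq] at hb
    exact hb ▸ hbR
  set Λ := M.filter fun R => ∀ Q ∈ M, ¬ Q ⊂ R with hΛ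
  have hinj : Set.InjOn p Λ := by
    intro R hR R' hR' heq
    rw [mem_coe, hΛ, mem_filter] at hR hR'
    obtain ⟨a, ha, haR⟩ := hp R hR.1
    have haR' := hmem R' hR'.1 a (heq ▸ ha)
    by_contra hne
    rcases hM R hR.1 R' hR'.1 with h | h | h
    · exact disjoint_left.1 h haR haR'
    · exact hR'.2 R hR.1 (Finset.ssubset_iff_subset_ne.2 ⟨h, hne⟩)
    · exact hR.2 R' hR'.1 (Finset.ssubset_iff_subset_ne.2 ⟨h, Ne.symm hne⟩)
  refine ⟨(Λ.image p).eraseNone, ?_, fun R hR => ?_⟩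
  · rw [← card_image_of_injOn hinj]
    have h2 : (Λ.image p).eraseNone.map Function.Embedding.some = Λ.image p := by
      rw [map_some_eraseNone, erase_eq_of_notMem]
      intro h
      obtain ⟨R, hR, hRn⟩ := mem_image.1 h
      obtain ⟨a, ha, -⟩ := hp R (mem_filter.1 hR).1
      rw [ha] at hRn
      exact absurd hRn (by simp)
    conv_rhs => rw [← h2, card_map]
  · obtain ⟨R', hR', hsub⟩ := exists_leaf_subset hR
    obtain ⟨a, ha, haR'⟩ := hp R' (mem_filter.1 hR').1
    exact ⟨a, mem_inter.2 ⟨mem_eraseNone.2 (mem_image.2 ⟨R', hR', ha⟩), hsub haR'⟩⟩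

lemma card_branching_filter_lt {M : Finset (Finset V)} (hM : FLaminar M) {X : Finset V}
    (hX : X.Nonempty) : (M.filter (Branching M X)).card + 1 ≤ X.card := by
  refine card_branching_lt (fun A hA B hB => hM A (mem_filter.1 hA).1 B (mem_filter.1 hB).1) hX ?_
  intro A hA
  obtain ⟨-, a, ha, b, hb, hab, haA, hbA, h⟩ := mem_filter.1 hA
  exact ⟨a, ha, b, hb, hab, haA, hbA, fun B hB => h B (mem_filter.1 hB).1⟩

lemma card_image_linkEdges_lt [Fintype V] {H M : Finset (Finset V)} (hH : FLaminar H)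
    (hMH : M ⊆ H) {hm : Sym2 V → Finset V} (hmH : ∀ e, hm e ∈ H) (hme : ∀ e, e ∈ (hm e).sym2)
    (hml : ∀ e, ∀ B ∈ H, e ∈ B.sym2 → hm e ⊆ B) {X : Finset V} (hX : X.Nonempty)
    (hXM : ∀ R ∈ M, (X ∩ R).Nonempty) (F : Finset (Sym2 V)) :
    ((F ∩ linkEdges M).image hm).card + 1 ≤ X.card := by
  have hsub : ∀ A ∈ (F ∩ linkEdges M).image hm, A ∈ H := by
    intro A hA
    obtain ⟨e, -, rfl⟩ := mem_image.1 hA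
    exact hmH e
  refine card_branching_lt (fun A hA B hB => hH A (hsub A hA) B (hsub B hB)) hX ?_
  intro A hA
  obtain ⟨e, he, rfl⟩ := mem_image.1 hA
  have he := (mem_inter.1 he).2
  simp only [linkEdges, touchEdges, mem_filter, mem_univ, true_and] at he
  obtain ⟨Q, hQ, Q', hQ', hd, ⟨u, hue, huQ⟩, v, hve, hvQ'⟩ := he
  obtain ⟨a, ha⟩ := hXM Q hQ
  obtain ⟨b, hb⟩ := hXM Q' hQ'
  rw [mem_inter] at ha hb
  have huv : e = s(u, v) := by
    have : u ≠ v := fun h => disjoint_left.1 hd huQ (h ▸ hvQ')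
    exact (Sym2.mem_and_mem_iff this).1 ⟨hue, hve⟩
  have hsubset : ∀ {B Q Q' : Finset V} {u v : V}, B ∈ H → Q ∈ M → Disjoint Q Q' → u ∈ B →
      u ∈ Q → v ∈ B → v ∈ Q' → Q ⊆ B := by
    intro B Q Q' u v hB hQ hd huB huQ hvB hvQ'
    rcases hH B hB Q (hMH hQ) with h | h | h
    · exact absurd huQ (disjoint_left.1 h huB)
    · exact absurd hvQ' (disjoint_left.1 hd (h hvB))
    · exact h
  have hmem := mem_sym2_iff.1 (hme e)
  refine ⟨a, ha.1, b, hb.1, fun h => disjoint_left.1 hd ha.2 (h ▸ hb.2),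
    hsubset (hmH e) hQ hd (hmem u hue) huQ (hmem v hve) hvQ' ha.2,
    hsubset (hmH e) hQ' hd.symm (hmem v hve) hvQ' (hmem u hue) huQ hb.2, fun B hB haB hbB => ?_⟩
  refine hml e B (hsub B hB) ?_
  have h1 := hsubset (hsub B hB) hQ hd haB ha.2 hbB hb.2 huQ
  have h2 := hsubset (hsub B hB) hQ' hd.symm hbB hb.2 haB ha.2 hvQ'
  rw [huv]
  simp [h1, h2]

lemma touchEdges_mono [Fintype V] {Q R : Finset V} (h : Q ⊆ R) :
    touchEdges Q ⊆ touchEdges R := by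
  intro e
  simp only [touchEdges, mem_filter, mem_univ, true_and]
  exact fun ⟨u, hu, huQ⟩ => ⟨u, hu, h huQ⟩

lemma crossEdges_subset_touchEdges [Fintype V] (R : Finset V) :
    crossEdges R ⊆ touchEdges R := by
  intro e
  simp only [crossEdges, touchEdges, mem_filter, mem_univ, true_and]
  exact fun h => h.1

/-- A member of `M` that is neither minimal nor branching has a greatest proper subset in `M`. -/
lemma exists_greatest_proper {M : Finset (Finset V)} (hM : FLaminar M) {X R : Finset V}
    (hXM : ∀ R ∈ M, (X ∩ R).Nonempty) (hR : R ∈ M) (hleaf : ¬ ∀ Q ∈ M, ¬ Q ⊂ R)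
    (hbr : ¬ Branching M X R) : ∃ Q ∈ M, Q ⊂ R ∧ ∀ Q' ∈ M, Q' ⊂ R → Q' ⊆ Q := by
  push Not at hleaf
  obtain ⟨Q0, hQ0, hQ0R⟩ := hleaf
  obtain ⟨Q, hQ⟩ := exists_maximal (s := M.filter (· ⊂ R)) ⟨Q0, mem_filter.2 ⟨hQ0, hQ0R⟩⟩
  obtain ⟨hQM, hQR⟩ := mem_filter.1 hQ.1
  have hmax : ∀ Q' ∈ M, Q' ⊂ R → Q ⊆ Q' → Q' ⊆ Q := fun Q' h1 h2 h3 =>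
    hQ.2 (mem_filter.2 ⟨h1, h2⟩) h3
  refine ⟨Q, hQM, hQR, fun Q' hQ' hQ'R => ?_⟩
  rcases hM Q hQM Q' hQ' with h | h | h
  · exfalso
    obtain ⟨a, ha⟩ := hXM Q hQM
    obtain ⟨b, hb⟩ := hXM Q' hQ'
    rw [mem_inter] at ha hb
    refine hbr ⟨a, ha.1, b, hb.1, fun he => disjoint_left.1 h ha.2 (he ▸ hb.2), hQR.1 ha.2,
      hQ'R.1 hb.2, fun B hB haB hbB => ?_⟩
    by_contra hRB
    rcases hM B hB R hR with h1 | h1 | h1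
    · exact disjoint_left.1 h1 haB (hQR.1 ha.2)
    · have h2 : B ⊂ R := ⟨h1, hRB⟩
      rcases hM B hB Q hQM with h3 | h3 | h3
      · exact disjoint_left.1 h3 haB ha.2
      · exact disjoint_left.1 h (h3 hbB) hb.2
      · exact disjoint_left.1 h (hmax B hB h2 h3 hbB) hb.2
    · exact hRB h1
  · exact hmax Q' hQ' hQ'R h
  · exact h
/-- The vectors supported on `F` that vanish on all sums over `A.sym2`, `A ∈ H`, and over
`crossEdges R`, `R ∈ M`, are trivial. -/
def Determines [Fintype V] (F : Finset (Sym2 V)) (H M : Finset (Finset V)) : Prop :=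
  ∀ y : Sym2 V → ℝ, (∀ e, e ∉ F → y e = 0) → (∀ A ∈ H, ∑ e ∈ A.sym2, y e = 0) →
    (∀ R ∈ M, ∑ e ∈ crossEdges R, y e = 0) → y = 0

/-- The coordinates where `z` is fractional. -/
def fracEdges [Fintype V] (z : Sym2 V → ℝ) : Finset (Sym2 V) :=
  univ.filter fun e => 0 < z e ∧ z e < 1

lemma two_le_card_lowEdges [Fintype V] {z : Sym2 V → ℝ} (hz : ForestPoint z)
    {H M : Finset (Finset V)} (hHt : ∀ A ∈ H, Tight z A) (hMH : M ⊆ H)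
    (hintegral : ∀ R ∈ M, ∃ n : ℤ, ∑ e ∈ crossEdges R, z e = n)
    (hdet : Determines (fracEdges z) H M) {Q R : Finset V} (hR : R ∈ M)
    (hmin : ¬ Determines (fracEdges z) H (M.erase R)) (hQ : Q ∈ M) (hQR : Q ⊂ R)
    (hgr : ∀ Q' ∈ M, Q' ⊂ R → Q' ⊆ Q) : 2 ≤ (fracEdges z ∩ lowEdges M R).card := by
  have hlow : lowEdges M R = touchEdges R \ touchEdges Q := by
    ext e
    simp only [lowEdges, mem_filter, mem_univ, true_and, mem_sdiff]
    exact and_congr_right fun _ => ⟨fun h => h Q hQ hQR,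
      fun h Q' hQ' hlt he => h (touchEdges_mono (hgr Q' hQ' hlt) he)⟩
  have hsd : ∀ y : Sym2 V → ℝ, ∑ e ∈ lowEdges M R, y e =
      ∑ e ∈ crossEdges R, y e + ∑ e ∈ R.sym2, y e -
        (∑ e ∈ crossEdges Q, y e + ∑ e ∈ Q.sym2, y e) := by
    intro y
    rw [← touchEdges_sum, ← touchEdges_sum, hlow,
      ← sum_sdiff (touchEdges_mono hQR.1), add_sub_cancel_right]
  have hne1 : (fracEdges z ∩ lowEdges M R).card ≠ 1 := by
    have h1 : ∃ n : ℤ, ∑ e ∈ lowEdges M R, z e = n := by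
      obtain ⟨n, hn⟩ := hintegral R hR
      obtain ⟨m, hm⟩ := hintegral Q hQ
      refine ⟨n + (R.card - 1) - (m + (Q.card - 1)), ?_⟩
      rw [hsd, hn, hm, (hHt R (hMH hR)).2, (hHt Q (hMH hQ)).2]
      push_cast
      ring
    have := card_frac_ne_one hz.1 hz.le_one h1
    rwa [fracEdges, inter_comm, ← filter_mem_eq_inter, filter_congr
      (q := fun e => 0 < z e ∧ z e < 1) (by simp)]
  have hne0 : (fracEdges z ∩ lowEdges M R).card ≠ 0 := by
    intro h0
    refine hmin fun y hyF hyH hyM => hdet y hyF hyH fun R' hR' => ?_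
    by_cases hRR : R' = R
    · subst hRR
      have h1 : ∑ e ∈ lowEdges M R', y e = 0 := by
        refine sum_eq_zero fun e he => hyF e fun heF => ?_
        have : e ∈ fracEdges z ∩ lowEdges M R' := mem_inter.2 ⟨heF, he⟩
        rw [card_eq_zero.1 h0] at this
        exact absurd this (notMem_empty e)
      have h2 := hsd y
      rw [h1, hyH R' (hMH hR'), hyH Q (hMH hQ), hyM Q (mem_erase.2 ⟨hQR.ne, hQ⟩)] at h2
      linarith
    · exact hyM R' (mem_erase.2 ⟨hRR, hR'⟩)
  omega

lemma fracEdges_eq_empty_of_minimal [Fintype V] {z : Sym2 V → ℝ} (hz : ForestPoint z)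
    {H M : Finset (Finset V)} (hH : FLaminar H) (huniv : univ ∈ H)
    (hHt : ∀ A ∈ H, Tight z A) (hMH : M ⊆ H)
    (hsix : ∀ R ∈ M, 6 ≤ (fracEdges z ∩ crossEdges R).card)
    (hintegral : ∀ R ∈ M, ∃ n : ℤ, ∑ e ∈ crossEdges R, z e = n)
    (hdet : Determines (fracEdges z) H M)
    (hmin : ∀ R ∈ M, ¬ Determines (fracEdges z) H (M.erase R)) : fracEdges z = ∅ := by
  have hlam : FLaminar M := fun A hA B hB => hH A (hMH hA) B (hMH hB)
  have hhm : ∀ e : Sym2 V, ∃ A ∈ H, e ∈ A.sym2 ∧ ∀ B ∈ H, e ∈ B.sym2 → A ⊆ B := fun e =>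
    exists_least_containing hH ⟨univ, huniv, by simp⟩
  choose hm hmH hme hml using hhm
  set F := fracEdges z with hF
  have hfib : ∀ A ∈ F.image hm, 2 ≤ (F.filter fun e => hm e = A).card := by
    intro A hA
    obtain ⟨e, he, rfl⟩ := mem_image.1 hA
    have h1 := card_frac_ne_one hz.1 hz.le_one (sum_fiber_int hHt hmH hme hml (hmH e))
    have h2 : (univ.filter fun e' => hm e' = hm e).filter (fun e => 0 < z e ∧ z e < 1) =
        F.filter fun e' => hm e' = hm e := by
      rw [hF, fracEdges, filter_comm]
    rw [h2] at h1
    have h3 : 0 < (F.filter fun e' => hm e' = hm e).card :=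
      card_pos.2 ⟨e, mem_filter.2 ⟨he, rfl⟩⟩
    omega
  have hdim : F.card ≤ (F.image hm).card + M.card := by
    have h1 := card_le_of_sums_determine F
      ((F.image hm).image (fun A => univ.filter fun e => hm e = A) ∪ M.image crossEdges) ?_
    · exact h1.trans ((card_union_le _ _).trans (add_le_add card_image_le card_image_le))
    · intro y hyF hy
      refine hdet y hyF (fun A hA => ?_) fun R hR => hy _ (mem_union_right _ (mem_image_of_mem _ hR))
      rw [sum_sym2_eq_sum_fibers hmH hme hml y hA]
      refine sum_eq_zero fun B _ => ?_
      by_cases hB : B ∈ F.image hm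
      · exact hy _ (mem_union_left _ (mem_image_of_mem (fun A => univ.filter fun e => hm e = A) hB))
      · refine sum_eq_zero fun e he => hyF e fun heF => hB ?_
        exact (mem_filter.1 he).2 ▸ mem_image_of_mem hm heF
  rcases M.eq_empty_or_nonempty with rfl | ⟨R0, hR0⟩
  · have h1 : (F.image hm).card * 2 ≤ F.card := by
      rw [card_eq_sum_card_image hm F]
      exact card_nsmul_le_sum _ _ 2 hfib
    rw [card_empty] at hdim
    exact card_eq_zero.1 (by omega)
  exfalso
  obtain ⟨X, hXcard, hXM⟩ := exists_leaf_points hlam fun R hR => (hHt R (hMH hR)).1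
  have hX : X.Nonempty := (hXM R0 hR0).mono inter_subset_left
  have hbr := card_branching_filter_lt hlam hX
  have hlink := card_image_linkEdges_lt hH hMH hmH hme hml hX hXM F
  have hlow := sum_card_lowEdges_le hlam F
  have hrest : ((F \ linkEdges M).image hm \ (F ∩ linkEdges M).image hm).card * 2 ≤
      (F \ linkEdges M).card := by
    set I := (F \ linkEdges M).image hm \ (F ∩ linkEdges M).image hm
    calc I.card * 2 ≤ ∑ A ∈ I, ((F \ linkEdges M).filter fun e => hm e = A).card := by
          refine card_nsmul_le_sum I _ 2 fun A hA => ?_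
          obtain ⟨hA1, hA2⟩ := mem_sdiff.1 hA
          refine (hfib A (image_subset_image sdiff_subset hA1)).trans (card_le_card fun e he => ?_)
          obtain ⟨heF, heA⟩ := mem_filter.1 he
          refine mem_filter.2 ⟨mem_sdiff.2 ⟨heF, fun hl => hA2 ?_⟩, heA⟩
          exact mem_image.2 ⟨e, mem_inter.2 ⟨heF, hl⟩, heA⟩
      _ ≤ ∑ A ∈ (F \ linkEdges M).image hm, ((F \ linkEdges M).filter fun e => hm e = A).card :=
          sum_le_sum_of_subset sdiff_subset
      _ = _ := (card_eq_sum_card_image hm _).symm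
  have himage : (F.image hm).card ≤ ((F ∩ linkEdges M).image hm).card +
      ((F \ linkEdges M).image hm \ (F ∩ linkEdges M).image hm).card := by
    have h1 : F.image hm = (F ∩ linkEdges M).image hm ∪
        ((F \ linkEdges M).image hm \ (F ∩ linkEdges M).image hm) := by
      rw [union_sdiff_self_eq_union, ← image_union]
      congr 1
      ext e
      simp only [mem_union, mem_inter, mem_sdiff]
      tauto
    exact (congrArg card h1).trans_le (card_union_le _ _)
  have hsplit : (F \ linkEdges M).card + (F ∩ linkEdges M).card = F.card :=
    card_sdiff_add_card_inter F _
  have hpoint : ∀ R ∈ M, 2 + 4 * (if ∀ Q ∈ M, ¬ Q ⊂ R then 1 else 0) ≤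
      (F ∩ lowEdges M R).card + 2 * (if Branching M X R then 1 else 0) := by
    intro R hR
    by_cases hleaf : ∀ Q ∈ M, ¬ Q ⊂ R
    · have h1 : F ∩ crossEdges R ⊆ F ∩ lowEdges M R := by
        refine inter_subset_inter_left fun e he => ?_
        exact mem_filter.2 ⟨mem_univ _, crossEdges_subset_touchEdges R he,
          fun Q hQ hlt => absurd hlt (hleaf Q hQ)⟩
      have h2 := hsix R hR
      have h3 := card_le_card h1
      rw [if_pos hleaf]
      omega
    · rw [if_neg hleaf]
      by_cases hb : Branching M X R
      · rw [if_pos hb]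
        omega
      · obtain ⟨Q, hQ, hQR, hgr⟩ := exists_greatest_proper hlam hXM hR hleaf hb
        have : 2 ≤ (F ∩ lowEdges M R).card :=
          two_le_card_lowEdges hz hHt hMH hintegral hdet hR (hmin R hR) hQ hQR hgr
        omega
  have hsum := sum_le_sum hpoint
  have hleaves : ∑ R ∈ M, (if ∀ Q ∈ M, ¬ Q ⊂ R then 1 else 0) = X.card := by
    rw [hXcard, card_filter]
    exact sum_congr rfl fun R _ => by congr
  have hbranch : ∑ R ∈ M, (if Branching M X R then 1 else 0) = (M.filter (Branching M X)).card := by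
    rw [card_filter]
  rw [sum_add_distrib, sum_add_distrib, ← mul_sum, ← mul_sum, hleaves, hbranch, sum_const,
    smul_eq_mul] at hsum
  omega

/-- If the tight sets of `H` and the integral cuts of `M` determine `z`, and every such cut has
at least six fractional coordinates, then `z` is integral. -/
lemma fracEdges_eq_empty [Fintype V] {z : Sym2 V → ℝ} (hz : ForestPoint z)
    {H M : Finset (Finset V)} (hH : FLaminar H) (huniv : univ ∈ H)
    (hHt : ∀ A ∈ H, Tight z A) (hMH : M ⊆ H)
    (hsix : ∀ R ∈ M, 6 ≤ (fracEdges z ∩ crossEdges R).card)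
    (hintegral : ∀ R ∈ M, ∃ n : ℤ, ∑ e ∈ crossEdges R, z e = n)
    (hdet : Determines (fracEdges z) H M) : fracEdges z = ∅ := by
  obtain ⟨N, hN⟩ := exists_minimal
    (s := M.powerset.filter fun N => Determines (fracEdges z) H N)
    ⟨M, mem_filter.2 ⟨mem_powerset_self M, hdet⟩⟩
  obtain ⟨hNM, hNdet⟩ := mem_filter.1 hN.1
  rw [mem_powerset] at hNM
  refine fracEdges_eq_empty_of_minimal hz hH huniv hHt (hNM.trans hMH)
    (fun R hR => hsix R (hNM hR)) (fun R hR => hintegral R (hNM hR)) hNdet fun R hR hdet' => ?_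
  have := hN.2 (mem_filter.2 ⟨mem_powerset.2 ((erase_subset R N).trans hNM), hdet'⟩)
    (erase_subset R N)
  exact absurd (this hR) (notMem_erase R N)
lemma ForestPoint.exists_step [Fintype V] {z : Sym2 V → ℝ} (hz : ForestPoint z) (y : Sym2 V → ℝ)
    {ι : Type*} [Finite ι] (A : ι → Finset (Sym2 V)) (β : ι → ℝ)
    (hA : ∀ i, ∑ e ∈ A i, z e ≤ β i) (hy0 : ∀ e, z e = 0 → 0 ≤ y e)
    (hyt : ∀ U, Tight z U → ∑ e ∈ U.sym2, y e ≤ 0)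
    (hyA : ∀ i, ∑ e ∈ A i, z e = β i → ∑ e ∈ A i, y e ≤ 0) :
    ∃ ε : ℝ, 0 < ε ∧ ForestPoint (z + ε • y) ∧ ∀ i, ∑ e ∈ A i, (z + ε • y) e ≤ β i := by
  obtain ⟨ε, hε, h⟩ := exists_pos_step
    (ι := Sym2 V ⊕ {U : Finset V // U.Nonempty} ⊕ ι)
    (Sum.elim (fun e => - z e) (Sum.elim (fun U => ∑ e ∈ U.1.sym2, z e) fun i => ∑ e ∈ A i, z e))
    (Sum.elim (fun e => - y e) (Sum.elim (fun U => ∑ e ∈ U.1.sym2, y e) fun i => ∑ e ∈ A i, y e))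
    (Sum.elim (fun _ => 0) (Sum.elim (fun U => U.1.card - 1) β))
    (by
      rintro (e | ⟨U, hU⟩ | i)
      · simpa using hz.1 e
      · exact hz.2 U hU
      · exact hA i)
    (by
      rintro (e | ⟨U, hU⟩ | i) h
      · simpa using hy0 e (by simpa using h)
      · exact hyt U ⟨hU, h⟩
      · exact hyA i h)
  have hsum : ∀ B : Finset (Sym2 V), ∑ e ∈ B, (z + ε • y) e =
      ∑ e ∈ B, z e + ε * ∑ e ∈ B, y e := by
    intro B
    simp [sum_add_distrib, mul_sum]
  refine ⟨ε, hε, ⟨fun e => ?_, fun U hU => ?_⟩, fun i => ?_⟩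
  · have := h (Sum.inl e)
    simp only [Sum.elim_inl, Pi.add_apply, Pi.smul_apply, smul_eq_mul] at this ⊢
    linarith
  · rw [hsum]
    exact h (Sum.inr (Sum.inl ⟨U, hU⟩))
  · rw [hsum]
    exact h (Sum.inr (Sum.inr i))

/-- The coordinates where `z` is nonzero. -/
def suppEdges [Fintype V] (z : Sym2 V → ℝ) : Finset (Sym2 V) :=
  univ.filter fun e => z e ≠ 0

lemma six_le_card_frac {ι : Type*} {f : ι → ℝ} (h0 : ∀ i, 0 ≤ f i) (h1 : ∀ i, f i ≤ 1)
    {A : Finset ι} {b : ℤ} (hA : ∑ i ∈ A, f i = b)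
    (hb : b + 4 < (A.filter fun i => f i ≠ 0).card) :
    6 ≤ (A.filter fun i => 0 < f i ∧ f i < 1).card := by
  set P := A.filter fun i => 0 < f i ∧ f i < 1 with hP
  set O := A.filter fun i => f i = 1 with hO
  have hsupp : A.filter (fun i => f i ≠ 0) = P ∪ O := by
    ext i
    have := (h0 i).lt_or_eq
    have := (h1 i).lt_or_eq
    simp only [hP, hO, mem_filter, mem_union]
    grind
  have hdis : Disjoint P O := by
    rw [disjoint_left]
    intro i hi hi'
    have := (mem_filter.1 hi).2.2
    have := (mem_filter.1 hi').2
    linarith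
  have hsum : ∑ i ∈ A, f i = ∑ i ∈ P, f i + O.card := by
    rw [← sum_filter_ne_zero, hsupp, sum_union hdis, card_eq_sum_ones O]
    push_cast
    congr 1
    exact sum_congr rfl fun i hi => (mem_filter.1 hi).2
  rw [hsupp, card_union_of_disjoint hdis] at hb
  have hPne : P.Nonempty := by
    rw [nonempty_iff_ne_empty]
    intro he
    rw [hA, he, sum_empty, zero_add] at hsum
    rw [he, card_empty, zero_add] at hb
    have : b = O.card := by exact_mod_cast hsum
    omega
  have hpos : 0 < ∑ i ∈ P, f i := sum_pos (fun i hi => (mem_filter.1 hi).2.1) hPne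
  have : (O.card : ℤ) < b := by
    have : (O.card : ℝ) < b := by linarith
    exact_mod_cast this
  push_cast at hb
  omega

/-- The face of the spanning tree polytope of `G` on which the members of `L` are tight. -/
def TreeFace (G : SimpleGraph V) (L : Finset (Finset V)) (z : Sym2 V → ℝ) : Prop :=
  ForestPoint z ∧ (∀ e, e ∉ G.edgeSet → z e = 0) ∧ ∀ U ∈ L, Tight z U

/-- Each cut of `L` respects its budget `b`, or has few coordinates left. -/
def Budgeted [Fintype V] (L : Finset (Finset V)) (b : Finset V → ℤ) (z : Sym2 V → ℝ) : Prop :=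
  ∀ R ∈ L, ∑ e ∈ crossEdges R, z e ≤ b R ∨ ((crossEdges R ∩ suppEdges z).card : ℤ) ≤ b R + 4

/-- One round of iterative relaxation: coordinates outside `fracEdges z` are frozen and cuts with
few coordinates are dropped. -/
def roundSet [Fintype V] (G : SimpleGraph V) (L : Finset (Finset V)) (b : Finset V → ℤ)
    (z : Sym2 V → ℝ) : Set (Sym2 V → ℝ) :=
  {z' | TreeFace G L z' ∧ (∀ e, e ∉ fracEdges z → z' e = z e) ∧
    ∀ R ∈ L, b R + 4 < ((crossEdges R ∩ suppEdges z).card : ℤ) →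
      ∑ e ∈ crossEdges R, z' e ≤ b R}

lemma isClosed_forestPoint : IsClosed {z : Sym2 V → ℝ | ForestPoint z} := by
  simp only [ForestPoint, Set.ofPred_and, Set.ofPred_forall]
  refine IsClosed.inter ?_ ?_
  · exact isClosed_iInter fun e => isClosed_le continuous_const (continuous_apply e)
  · exact isClosed_iInter fun U => isClosed_iInter fun _ =>
      isClosed_le (by fun_prop) continuous_const

lemma isClosed_tight (U : Finset V) : IsClosed {z : Sym2 V → ℝ | Tight z U} := by
  simp only [Tight, Set.ofPred_and]
  exact isClosed_const.inter (isClosed_eq (by fun_prop) continuous_const)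

lemma isCompact_of_forestPoint {K : Set (Sym2 V → ℝ)} (hK : IsClosed K)
    (h : ∀ z ∈ K, ForestPoint z) : IsCompact K :=
  IsCompact.of_isClosed_subset (isCompact_Icc (a := (0 : Sym2 V → ℝ)) (b := 1)) hK
    fun z hz => ⟨fun e => (h z hz).1 e, fun e => (h z hz).le_one e⟩

lemma isCompact_roundSet [Fintype V] (G : SimpleGraph V) (L : Finset (Finset V))
    (b : Finset V → ℤ) (z : Sym2 V → ℝ) : IsCompact (roundSet G L b z) := by
  refine isCompact_of_forestPoint ?_ fun z' hz' => hz'.1.1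
  simp only [roundSet, TreeFace, Set.ofPred_and, Set.ofPred_forall]
  refine ((isClosed_forestPoint.inter (IsClosed.inter ?_ ?_)).inter (IsClosed.inter ?_ ?_))
  · exact isClosed_iInter fun e => isClosed_iInter fun _ =>
      isClosed_eq (continuous_apply e) continuous_const
  · exact isClosed_iInter fun U => isClosed_iInter fun _ => isClosed_tight U
  · exact isClosed_iInter fun e => isClosed_iInter fun _ =>
      isClosed_eq (continuous_apply e) continuous_const
  · exact isClosed_iInter fun R => isClosed_iInter fun _ => isClosed_iInter fun _ =>
      isClosed_le (by fun_prop) continuous_const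

/-- A linear functional attains its minimum over a compact set at a point that is not in the
interior of a segment of the set. -/
lemma exists_extreme_minimizer [Fintype V] {K : Set (Sym2 V → ℝ)} (hK : IsCompact K)
    (hne : K.Nonempty) (c : Sym2 V → ℝ) :
    ∃ z ∈ K, (∀ w ∈ K, ∑ e, c e * z e ≤ ∑ e, c e * w e) ∧
      ∀ y : Sym2 V → ℝ, ∀ ε > (0 : ℝ), ∀ δ > (0 : ℝ), z + ε • y ∈ K → z + δ • (-y) ∈ K → y = 0 := by
  have hcont : Continuous fun z : Sym2 V → ℝ => ∑ e, c e * z e := by fun_prop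
  set A := K ∩ {z | ∀ w ∈ K, ∑ e, c e * z e ≤ ∑ e, c e * w e} with hA
  have hAc : IsCompact A := by
    refine hK.inter_right ?_
    simp only [Set.ofPred_forall]
    exact isClosed_iInter fun w => isClosed_iInter fun _ => isClosed_le hcont continuous_const
  have hAne : A.Nonempty := by
    obtain ⟨z, hz, hmin⟩ := hK.exists_isMinOn hne hcont.continuousOn
    exact ⟨z, hz, fun w hw => hmin hw⟩
  obtain ⟨z, hz⟩ := hAc.extremePoints_nonempty hAne
  refine ⟨z, hz.1.1, hz.1.2, fun y ε hε δ hδ h1 h2 => ?_⟩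
  have hlin : ∀ (r : ℝ) (u : Sym2 V → ℝ),
      ∑ e, c e * (z + r • u) e = ∑ e, c e * z e + r * ∑ e, c e * u e := by
    intro r u
    rw [mul_sum, ← sum_add_distrib]
    exact sum_congr rfl fun e _ => by simp; ring
  have hneg : ∑ e, c e * (-y) e = - ∑ e, c e * y e := by simp
  have g1 := hz.1.2 _ h1
  have g2 := hz.1.2 _ h2
  rw [hlin] at g1 g2
  rw [hneg] at g2
  have g3 : ∑ e, c e * y e = 0 := by
    refine le_antisymm ?_ ?_
    · by_contra! h
      nlinarith [mul_pos hδ h]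
    · by_contra! h
      nlinarith [mul_pos_of_neg_of_neg (neg_neg_of_pos hε) h]
  have m1 : z + ε • y ∈ A := ⟨h1, fun w hw => by rw [hlin, g3, mul_zero, add_zero]; exact hz.1.2 w hw⟩
  have m2 : z + δ • (-y) ∈ A :=
    ⟨h2, fun w hw => by rw [hlin, hneg, g3, neg_zero, mul_zero, add_zero]; exact hz.1.2 w hw⟩
  have hseg : z ∈ openSegment ℝ (z + ε • y) (z + δ • (-y)) := by
    refine ⟨δ / (ε + δ), ε / (ε + δ), by positivity, by positivity, by field_simp; ring, ?_⟩
    ext e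
    simp only [Pi.add_apply, Pi.smul_apply, Pi.neg_apply, smul_eq_mul]
    field_simp
    ring
  have := (mem_extremePoints.1 hz).2 _ m1 _ m2 hseg
  have h3 := this.1
  rw [add_eq_left] at h3
  exact (smul_eq_zero.1 h3).resolve_left hε.ne'
lemma exists_step_mem_roundSet [Fintype V] {G : SimpleGraph V} {L : Finset (Finset V)}
    {b : Finset V → ℤ} {z z' y : Sym2 V → ℝ} (hz' : z' ∈ roundSet G L b z)
    (hyF : ∀ e, e ∉ fracEdges z → y e = 0) (hy0 : ∀ e, z' e = 0 → y e = 0)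
    (hyt : ∀ U, Tight z' U → ∑ e ∈ U.sym2, y e = 0)
    (hyM : ∀ R ∈ L, b R + 4 < ((crossEdges R ∩ suppEdges z).card : ℤ) →
      ∑ e ∈ crossEdges R, z' e = b R → ∑ e ∈ crossEdges R, y e = 0) :
    ∃ ε > (0 : ℝ), z' + ε • y ∈ roundSet G L b z := by
  obtain ⟨ε, hε, hf, h⟩ := hz'.1.1.exists_step y
    (ι := {R : Finset V // R ∈ L ∧ b R + 4 < ((crossEdges R ∩ suppEdges z).card : ℤ)})
    (fun R => crossEdges R.1) (fun R => b R.1) (fun R => hz'.2.2 R.1 R.2.1 R.2.2)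
    (fun e he => (hy0 e he).ge) (fun U hU => (hyt U hU).le)
    (fun R hR => (hyM R.1 R.2.1 R.2.2 hR).le)
  refine ⟨ε, hε, ⟨hf, fun e he => ?_, fun U hU => ?_⟩, fun e he => ?_,
    fun R hR hlt => h ⟨R, hR, hlt⟩⟩
  · have := hz'.1.2.1 e he
    simp [this, hy0 e this]
  · have hU' := hz'.1.2.2 U hU
    have := hyt U hU'
    refine ⟨hU'.1, ?_⟩
    simp only [Pi.add_apply, Pi.smul_apply, smul_eq_mul]
    rw [sum_add_distrib, ← mul_sum, this, hU'.2, mul_zero, add_zero]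
  · simp [hz'.2.1 e he, hyF e he]

lemma frac_inter [Fintype V] (z : Sym2 V → ℝ) (A : Finset (Sym2 V)) :
    fracEdges z ∩ A = A.filter fun e => 0 < z e ∧ z e < 1 := by
  ext e
  simp [fracEdges, and_comm]

lemma inter_supp [Fintype V] (z : Sym2 V → ℝ) (A : Finset (Sym2 V)) :
    A ∩ suppEdges z = A.filter fun e => z e ≠ 0 := by
  ext e
  simp [suppEdges]

/-- Iterative relaxation: a fractional point of the face can be rounded without increasing its cost,
exceeding the budget of every cut by at most `4`. -/
lemma exists_integral_point [Fintype V] {G : SimpleGraph V} {L : Finset (Finset V)}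
    (hL : FLaminar L) (huniv : univ ∈ L) (b : Finset V → ℤ) (c z : Sym2 V → ℝ)
    (hz : TreeFace G L z) (hb : Budgeted L b z) :
    ∃ z', TreeFace G L z' ∧ Budgeted L b z' ∧ ∑ e, c e * z' e ≤ ∑ e, c e * z e ∧
      fracEdges z' = ∅ := by
  induction hn : (fracEdges z).card using Nat.strong_induction_on generalizing z with | _ n ih =>
  have hzK : z ∈ roundSet G L b z :=
    ⟨hz, fun _ _ => rfl, fun R hR hlt => (hb R hR).resolve_right (not_le.2 hlt)⟩
  obtain ⟨w, hwK, hwmin, hext⟩ := exists_extreme_minimizer (isCompact_roundSet G L b z) ⟨z, hzK⟩ c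
  have hzero : ∀ e, z e = 0 → w e = 0 := by
    intro e he
    rw [hwK.2.1 e (by simp [fracEdges, he]), he]
  have hfrac : fracEdges w ⊆ fracEdges z := by
    intro e he
    by_contra hne
    have h1 := hwK.2.1 e hne
    simp only [fracEdges, mem_filter, mem_univ, true_and] at he hne
    exact hne (h1 ▸ he)
  have hsupp : suppEdges w ⊆ suppEdges z := by
    intro e
    simp only [suppEdges, mem_filter, mem_univ, true_and]
    exact fun h h0 => h (hzero e h0)
  have hwb : Budgeted L b w := by
    intro R hR
    by_cases hlt : b R + 4 < ((crossEdges R ∩ suppEdges z).card : ℤ)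
    · exact Or.inl (hwK.2.2 R hR hlt)
    · right
      refine le_trans ?_ (not_lt.1 hlt)
      exact_mod_cast card_le_card (inter_subset_inter_left hsupp)
  rcases (card_le_card hfrac).lt_or_eq with hlt | heq
  · obtain ⟨z', h1, h2, h3, h4⟩ := ih _ (hn ▸ hlt) w hwK.1 hwb rfl
    exact ⟨z', h1, h2, h3.trans (hwmin z hzK), h4⟩
  have hF : fracEdges w = fracEdges z := eq_of_subset_of_card_le hfrac heq.ge
  have hs : suppEdges w = suppEdges z := by
    refine subset_antisymm hsupp fun e he => ?_
    simp only [suppEdges, mem_filter, mem_univ, true_and] at he ⊢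
    by_cases hef : e ∈ fracEdges z
    · rw [← hF] at hef
      exact (mem_filter.1 hef).2.1.ne'
    · rwa [hwK.2.1 e hef]
  refine ⟨w, hwK.1, hwb, hwmin z hzK, ?_⟩
  obtain ⟨H, hLH, hH, hHt, hspan⟩ := exists_laminar_spanning hwK.1.1 hL hwK.1.2.2
  set M := L.filter fun R => b R + 4 < ((crossEdges R ∩ suppEdges z).card : ℤ) ∧
    ∑ e ∈ crossEdges R, w e = b R with hM
  refine fracEdges_eq_empty hwK.1.1 hH (hLH huniv) hHt (M := M)
    ((filter_subset _ _).trans hLH) (fun R hR => ?_) (fun R hR => ?_) ?_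
  · obtain ⟨-, hR1, hR2⟩ := mem_filter.1 hR
    rw [frac_inter]
    refine six_le_card_frac hwK.1.1.1 hwK.1.1.le_one hR2 ?_
    rwa [← inter_supp, hs]
  · exact ⟨b R, (mem_filter.1 hR).2.2⟩
  · intro y hyF hyH hyM
    have hy0 : ∀ e, w e = 0 → y e = 0 := fun e he => hyF e (by simp [fracEdges, he])
    have hyt := hspan y hy0 hyH
    have hyM' : ∀ R ∈ L, b R + 4 < ((crossEdges R ∩ suppEdges z).card : ℤ) →
        ∑ e ∈ crossEdges R, w e = b R → ∑ e ∈ crossEdges R, y e = 0 :=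
      fun R hR h1 h2 => hyM R (mem_filter.2 ⟨hR, h1, h2⟩)
    obtain ⟨ε, hε, h1⟩ := exists_step_mem_roundSet hwK (fun e he => hyF e (hF ▸ he)) hy0 hyt hyM'
    obtain ⟨δ, hδ, h2⟩ := exists_step_mem_roundSet (y := -y) hwK
      (fun e he => by simp [hyF e (hF ▸ he)]) (fun e he => by simp [hy0 e he])
      (fun U hU => by simp [hyt U hU]) (fun R hR h1 h2 => by simp [hyM' R hR h1 h2])
    exact hext y ε hε δ hδ h1 h2

/-- The graph of the edges where `z` equals `1`. -/
def oneGraph (z : Sym2 V → ℝ) : SimpleGraph V :=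
  SimpleGraph.fromEdgeSet {e | z e = 1}

lemma oneGraph_isTree [Fintype V] [Nonempty V] {z : Sym2 V → ℝ} (hz : ForestPoint z)
    (ht : Tight z univ) (hdiag : ∀ v, z s(v, v) = 0) (h01 : ∀ e, z e = 0 ∨ z e = 1) :
    (oneGraph z).IsTree := by
  have hedge : (oneGraph z).edgeSet = {e | z e = 1} := by
    ext e
    induction e with | _ a b =>
    simp only [oneGraph, SimpleGraph.mem_edgeSet, SimpleGraph.fromEdgeSet_adj, Set.mem_ofPred_eq]
    refine ⟨fun h => h.1, fun h => ⟨h, ?_⟩⟩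
    rintro rfl
    rw [hdiag] at h
    exact zero_ne_one h
  rw [SimpleGraph.isTree_iff_connected_and_card]
  constructor
  · refine ⟨?_⟩
    by_contra hpre
    simp only [SimpleGraph.Preconnected, not_forall] at hpre
    obtain ⟨u, v, huv⟩ := hpre
    refine not_tight_of_split hz (D := univ) (S := univ.filter fun w => (oneGraph z).Reachable u w)
      ?_ ⟨u, by simp⟩ ⟨v, by simpa using huv⟩ ht
    intro e _ he
    refine (h01 e).resolve_right fun h1 => ?_
    simp only [crossEdges, mem_filter, mem_univ, true_and] at he
    obtain ⟨⟨p, hp, hup⟩, q, hq, huq⟩ := he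
    have hpq : p ≠ q := fun h => huq (h ▸ hup)
    have he : e = s(p, q) := (Sym2.mem_and_mem_iff hpq).1 ⟨hp, hq⟩
    have hadj : (oneGraph z).Adj p q := by
      rw [← SimpleGraph.mem_edgeSet, hedge, ← he]
      exact h1
    exact huq (hup.trans hadj.reachable)
  · have h1 : (Nat.card (oneGraph z).edgeSet : ℝ) = ∑ e ∈ (univ : Finset V).sym2, z e := by
      rw [hedge, Nat.card_eq_fintype_card, Fintype.card_subtype, card_eq_sum_ones]
      push_cast
      rw [sum_filter, sym2_univ]
      refine sum_congr rfl fun e _ => ?_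
      rcases h01 e with h | h <;> simp [h]
    rw [ht.2, card_univ] at h1
    rw [Nat.card_eq_fintype_card (α := V)]
    have : (Nat.card (oneGraph z).edgeSet : ℝ) + 1 = Fintype.card V := by linarith
    exact_mod_cast this

lemma exists_rounded_tree [Fintype V] [Nonempty V] {G : SimpleGraph V} {L : Finset (Finset V)}
    (hL : FLaminar L) (huniv : univ ∈ L) (b : Finset V → ℤ) (c z : Sym2 V → ℝ)
    (hz : TreeFace G L z) (hb : ∀ R ∈ L, ∑ e ∈ crossEdges R, z e ≤ b R) :
    ∃ T : SimpleGraph V, T ≤ G ∧ T.IsTree ∧ ∑ e ∈ T.edgeFinset, c e ≤ ∑ e, c e * z e ∧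
      ∀ R ∈ L, ((T.edgeFinset ∩ crossEdges R).card : ℤ) ≤ b R + 4 := by
  obtain ⟨w, hw, hwb, hwc, hwf⟩ :=
    exists_integral_point hL huniv b c z hz fun R hR => Or.inl (hb R hR)
  have h01 : ∀ e, w e = 0 ∨ w e = 1 := by
    intro e
    by_contra! h
    have : e ∈ fracEdges w := by
      simp only [fracEdges, mem_filter, mem_univ, true_and]
      exact ⟨(hw.1.1 e).lt_of_ne' h.1, (hw.1.le_one e).lt_of_ne h.2⟩
    rw [hwf] at this
    exact notMem_empty e this
  have hedge : (oneGraph w).edgeFinset = suppEdges w := by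
    ext e
    induction e with | _ p q =>
    rw [SimpleGraph.mem_edgeFinset]
    simp only [oneGraph, SimpleGraph.mem_edgeSet,
      SimpleGraph.fromEdgeSet_adj, Set.mem_ofPred_eq, suppEdges, mem_filter, mem_univ, true_and]
    refine ⟨fun h => by rw [h.1]; exact one_ne_zero, fun h => ⟨(h01 _).resolve_left h, ?_⟩⟩
    rintro rfl
    exact h (hw.2.1 _ (by simp))
  refine ⟨oneGraph w, ?_, oneGraph_isTree hw.1 (hw.2.2 _ huniv) (fun v => hw.2.1 _ (by simp)) h01,
    ?_, fun R hR => ?_⟩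
  · intro p q hpq
    have h1 : s(p, q) ∈ suppEdges w := by
      rw [← hedge, SimpleGraph.mem_edgeFinset]
      exact hpq
    by_contra h
    exact (mem_filter.1 h1).2 (hw.2.1 s(p, q) h)
  · refine le_trans (le_of_eq ?_) hwc
    rw [hedge, suppEdges, sum_filter]
    refine sum_congr rfl fun e _ => ?_
    rcases h01 e with h | h <;> simp [h]
  · rw [hedge, inter_comm]
    rcases hwb R hR with h | h
    · have h1 : ((crossEdges R ∩ suppEdges w).card : ℝ) = ∑ e ∈ crossEdges R, w e := by
        rw [inter_supp, card_eq_sum_ones]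
        push_cast
        rw [sum_filter]
        refine sum_congr rfl fun e _ => ?_
        rcases h01 e with h | h <;> simp [h]
      rw [← h1] at h
      have : ((crossEdges R ∩ suppEdges w).card : ℤ) ≤ b R := by exact_mod_cast h
      omega
    · exact h
lemma card_edgeFinset_inter_sym2_le [Fintype V] {T : SimpleGraph V} (hT : T.IsAcyclic)
    {U : Finset V} (hU : U.Nonempty) :
    ((T.edgeFinset ∩ U.sym2).card : ℝ) ≤ U.card - 1 := by
  have : Nonempty (U : Set V) := hU.coe_sort
  obtain ⟨F, hF, -, hFt⟩ := SimpleGraph.connected_top.exists_isTree_le_of_le_of_isAcyclic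
    le_top (hT.induce (U : Set V))
  have h1 : (T.edgeFinset ∩ U.sym2).card = (T.induce (U : Set V)).edgeFinset.card := by
    have h2 := congrArg Finset.card
      (SimpleGraph.map_edgeFinset_induce (s := (U : Set V)) (G := T))
    rw [card_map, toFinset_coe] at h2
    convert h2.symm
  have h2 := card_le_card (SimpleGraph.edgeFinset_mono hF)
  have h3 := hFt.card_edgeFinset
  have h4 : Fintype.card (U : Set V) = U.card := by simp
  rw [h4] at h3
  have h5 : (T.edgeFinset ∩ U.sym2).card + 1 ≤ U.card := by
    rw [h1, ← h3]
    gcongr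
  have h6 : ((T.edgeFinset ∩ U.sym2).card : ℝ) + 1 ≤ U.card := by exact_mod_cast h5
  linarith

lemma convex_forestPoint : Convex ℝ {z : Sym2 V → ℝ | ForestPoint z} := by
  intro z hz w hw a b ha hb hab
  refine ⟨fun e => ?_, fun U hU => ?_⟩
  · exact add_nonneg (mul_nonneg ha (hz.1 e)) (mul_nonneg hb (hw.1 e))
  · simp only [Pi.add_apply, Pi.smul_apply, smul_eq_mul]
    rw [sum_add_distrib, ← mul_sum, ← mul_sum]
    have h1 := mul_le_mul_of_nonneg_left (hz.2 U hU) ha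
    have h2 := mul_le_mul_of_nonneg_left (hw.2 U hU) hb
    have h3 : a * ((U.card : ℝ) - 1) + b * (U.card - 1) = U.card - 1 := by
      rw [← add_mul, hab, one_mul]
    linarith

lemma convex_tight (U : Finset V) : Convex ℝ {z : Sym2 V → ℝ | Tight z U} := by
  intro z hz w hw a b ha hb hab
  refine ⟨hz.1, ?_⟩
  simp only [Pi.add_apply, Pi.smul_apply, smul_eq_mul]
  rw [sum_add_distrib, ← mul_sum, ← mul_sum, hz.2, hw.2, ← add_mul, hab, one_mul]

lemma treeFace_of_mem_stPolytope [Fintype V] {G : SimpleGraph V} {x : Sym2 V → ℝ}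
    (hx : x ∈ stPolytope G) : TreeFace G {univ} x := by
  refine convexHull_min (t := {z | TreeFace G {univ} z}) ?_ ?_ hx
  · rintro y ⟨T, hTG, hT, rfl⟩
    have hsum : ∀ U : Finset V, ∑ e ∈ U.sym2, (if e ∈ T.edgeSet then (1 : ℝ) else 0) =
        (T.edgeFinset ∩ U.sym2).card := by
      intro U
      rw [← sum_filter, sum_const, nsmul_one, inter_comm, ← filter_mem_eq_inter]
      simp only [SimpleGraph.mem_edgeFinset]
    refine ⟨⟨fun e => by positivity, fun U hU => ?_⟩, fun e he => ?_, fun U hU => ?_⟩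
    · rw [hsum]
      exact card_edgeFinset_inter_sym2_le hT.isAcyclic hU
    · exact if_neg fun h => he (SimpleGraph.edgeSet_mono hTG h)
    · rw [mem_singleton.1 hU]
      have := hT.connected.nonempty
      refine ⟨univ_nonempty, ?_⟩
      rw [hsum, sym2_univ, inter_univ, card_univ, ← hT.card_edgeFinset]
      simp
  · refine convex_forestPoint.inter (Convex.inter ?_ ?_)
    · intro z hz w hw a b _ _ _ e he
      simp [hz e he, hw e he]
    · intro z hz w hw a b ha hb hab U hU
      obtain rfl := mem_singleton.1 hU
      exact convex_tight univ (hz univ hU) (hw univ hU) ha hb hab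

/-- In a point maximising the total mass inside the members of a laminar family, unsaturated
coordinates inside a member lie in a tight subset of that member. -/
lemma exists_saturated [Fintype V] {L : Finset (Finset V)} (hL : FLaminar L) {x w : Sym2 V → ℝ}
    (hx : ForestPoint x) (hxt : Tight x univ) (hxw : x ≤ w) :
    ∃ z, ForestPoint z ∧ Tight z univ ∧ z ≤ w ∧
      ∀ S ∈ L, ∀ e ∈ S.sym2, z e < w e → ∃ U ⊆ S, Tight z U ∧ e ∈ U.sym2 := by
  have hcomp : IsCompact {z : Sym2 V → ℝ | ForestPoint z ∧ Tight z univ ∧ z ≤ w} :=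
    isCompact_of_forestPoint (isClosed_forestPoint.inter ((isClosed_tight univ).inter isClosed_Iic))
      fun z hz => hz.1
  obtain ⟨z, ⟨hz, hzt, hzw⟩, hmax⟩ := hcomp.exists_isMaxOn ⟨x, hx, hxt, hxw⟩
    (f := fun z => ∑ S ∈ L, ∑ e ∈ S.sym2, z e) (by fun_prop)
  refine ⟨z, hz, hzt, hzw, fun S hS e he hlt => ?_⟩
  obtain ⟨D, hD⟩ := exists_minimal (s := univ.filter fun D => Tight z D ∧ e ∈ D.sym2)
    ⟨univ, by simp [hzt]⟩
  have hDm : ∀ U, Tight z U → e ∈ U.sym2 → U ⊆ D → D ⊆ U := fun U h1 h2 h3 =>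
    hD.2 (mem_filter.2 ⟨mem_univ _, h1, h2⟩) h3
  obtain ⟨-, hDt, heD⟩ := mem_filter.1 hD.1
  by_contra hno
  have hDS : ¬ D ⊆ S := fun h => hno ⟨D, h, hDt, heD⟩
  have hemem : ∀ U : Finset V, e ∈ U.sym2 → e.out.1 ∈ U := fun U h =>
    mem_sym2_iff.1 h _ (Sym2.out_fst_mem e)
  have hf : ∃ f ∈ D.sym2, f ∈ crossEdges S ∧ z f ≠ 0 := by
    by_contra! h
    exact not_tight_of_split hz h ⟨e.out.1, mem_inter.2 ⟨hemem D heD, hemem S he⟩⟩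
      (sdiff_nonempty.2 hDS) hDt
  obtain ⟨f, hfD, hfS, hzf⟩ := hf
  have hfnot : f ∉ S.sym2 := by
    simp only [crossEdges, mem_filter, mem_univ, true_and] at hfS
    rw [mem_sym2_iff]
    exact fun h => let ⟨v, hv, hvS⟩ := hfS.2; hvS (h v hv)
  set y : Sym2 V → ℝ := Pi.single e 1 - Pi.single f 1 with hy
  have hysum : ∀ A : Finset (Sym2 V), ∑ g ∈ A, y g =
      (if e ∈ A then 1 else 0) - if f ∈ A then 1 else 0 := by
    intro A
    simp [hy]
  have hsingle : ∀ a g : Sym2 V, 0 ≤ (Pi.single a 1 : Sym2 V → ℝ) g := fun a g => by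
    rw [Pi.single_apply]
    positivity
  have hstep : ∀ U, Tight z U → e ∈ U.sym2 → f ∈ U.sym2 := by
    intro U hU heU
    have h1 := (tight_inter_union hz hU hDt
      ⟨e.out.1, mem_inter.2 ⟨hemem U heU, hemem D heD⟩⟩).1
    have h2 := hDm _ h1 (by rw [← sym2_inter_eq]; exact mem_inter.2 ⟨heU, heD⟩) inter_subset_right
    exact sym2_mono (h2.trans inter_subset_left) hfD
  obtain ⟨ε, hε, hzf', hzw'⟩ := hz.exists_step y (fun g : Sym2 V => {g}) w
    (fun g => by simpa using hzw g)
    (fun g hg => by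
      have : g ≠ f := fun h => hzf (h ▸ hg)
      rw [hy, Pi.sub_apply, Pi.single_eq_of_ne this, sub_zero]
      exact hsingle e g)
    (fun U hU => by
      rw [hysum]
      have := hstep U hU
      split_ifs <;> simp_all)
    (fun g hg => by
      rw [sum_singleton] at hg
      have : g ≠ e := fun h => hlt.ne (h ▸ hg)
      rw [sum_singleton, hy, Pi.sub_apply, Pi.single_eq_of_ne this, zero_sub, neg_nonpos]
      exact hsingle f g)
  have hsum : ∀ B : Finset (Sym2 V), ∑ e ∈ B, (z + ε • y) e =
      ∑ e ∈ B, z e + ε * ∑ e ∈ B, y e := by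
    intro B
    simp [sum_add_distrib, mul_sum]
  have hle := hmax (a := z + ε • y) ⟨hzf', ⟨hzt.1, by rw [hsum, hysum, hzt.2]; simp⟩,
    fun g => by simpa using hzw' g⟩
  simp only [Set.mem_ofPred_eq, hsum] at hle
  rw [sum_add_distrib, ← mul_sum] at hle
  have hpos : 0 < ∑ S' ∈ L, ∑ g ∈ S'.sym2, y g := by
    refine sum_pos' (fun S' hS' => ?_) ⟨S, hS, ?_⟩
    · rw [hysum]
      have h1 : f ∈ S'.sym2 → e ∈ S'.sym2 := by
        intro hfS'
        refine sym2_mono ?_ he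
        simp only [crossEdges, mem_filter, mem_univ, true_and] at hfS
        obtain ⟨⟨p, hp, hpS⟩, q, hq, hqS⟩ := hfS
        rcases hL S hS S' hS' with h | h | h
        · exact absurd (mem_sym2_iff.1 hfS' p hp) (disjoint_left.1 h hpS)
        · exact h
        · exact absurd (h (mem_sym2_iff.1 hfS' q hq)) hqS
      split_ifs <;> simp_all
    · rw [hysum, if_pos he, if_neg hfnot]
      norm_num
  nlinarith [mul_pos hε hpos]
/-- The maximal tight subsets of `S`. -/
def tightParts [Fintype V] (z : Sym2 V → ℝ) (S : Finset V) : Finset (Finset V) :=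
  univ.filter fun P => Maximal (fun U => Tight z U ∧ U ⊆ S) P

section tightParts

variable [Fintype V] {z : Sym2 V → ℝ} {S P Q U : Finset V}

lemma tight_of_mem_tightParts (hP : P ∈ tightParts z S) : Tight z P :=
  (mem_filter.1 hP).2.1.1

lemma subset_of_mem_tightParts (hP : P ∈ tightParts z S) : P ⊆ S :=
  (mem_filter.1 hP).2.1.2

lemma exists_tightPart (hU : Tight z U) (hUS : U ⊆ S) : ∃ P ∈ tightParts z S, U ⊆ P := by
  obtain ⟨P, hUP, hP⟩ := (univ.filter fun U => Tight z U ∧ U ⊆ S).exists_le_maximal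
    (a := U) (by simp [hU, hUS])
  refine ⟨P, mem_filter.2 ⟨mem_univ _, ?_⟩, hUP⟩
  simpa using hP

lemma subset_tightPart (hz : ForestPoint z) (hP : P ∈ tightParts z S) (hU : Tight z U)
    (hUS : U ⊆ S) (hne : ¬ Disjoint U P) : U ⊆ P := by
  have h1 := (mem_filter.1 hP).2
  have h2 := (tight_inter_union hz hU h1.1.1 (not_disjoint_iff_nonempty_inter.1 hne)).2.1
  exact subset_union_left.trans (h1.2 ⟨h2, union_subset hUS h1.1.2⟩ subset_union_right)

lemma disjoint_tightParts (hz : ForestPoint z) (hP : P ∈ tightParts z S)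
    (hQ : Q ∈ tightParts z S) (hne : P ≠ Q) : Disjoint P Q := by
  by_contra h
  exact hne (subset_antisymm
    (subset_tightPart hz hQ (tight_of_mem_tightParts hP) (subset_of_mem_tightParts hP) h)
    (subset_tightPart hz hP (tight_of_mem_tightParts hQ) (subset_of_mem_tightParts hQ)
      fun h' => h h'.symm))

lemma biUnion_tightParts (hz : ForestPoint z) : (tightParts z S).biUnion id = S := by
  ext v
  simp only [mem_biUnion, id]
  refine ⟨fun ⟨P, hP, hv⟩ => subset_of_mem_tightParts hP hv, fun hv => ?_⟩
  obtain ⟨P, hP, hvP⟩ := exists_tightPart (tight_singleton hz v) (singleton_subset_iff.2 hv)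
  exact ⟨P, hP, hvP (mem_singleton_self v)⟩

lemma fLaminar_biUnion_tightParts (hz : ForestPoint z) {L : Finset (Finset V)}
    (hL : FLaminar L) : FLaminar (L.biUnion (tightParts z)) := by
  intro P hP Q hQ
  obtain ⟨S, hS, hPS⟩ := mem_biUnion.1 hP
  obtain ⟨S', hS', hQS⟩ := mem_biUnion.1 hQ
  have hP' := subset_of_mem_tightParts hPS
  have hQ' := subset_of_mem_tightParts hQS
  rw [or_iff_not_imp_left]
  intro hne
  rcases hL S hS S' hS' with h | h | h
  · exact absurd (disjoint_of_subset_left hP' (disjoint_of_subset_right hQ' h)) hne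
  · exact Or.inl (subset_tightPart hz hQS (tight_of_mem_tightParts hPS) (hP'.trans h) hne)
  · exact Or.inr (subset_tightPart hz hPS (tight_of_mem_tightParts hQS) (hQ'.trans h)
      fun h' => hne h'.symm)

/-- The pairs inside `S` joining distinct parts. -/
def betweenEdges (z : Sym2 V → ℝ) (S : Finset V) : Finset (Sym2 V) :=
  S.sym2 \ (tightParts z S).biUnion Finset.sym2

lemma sum_betweenEdges_le (hz : ForestPoint z) (hS : S.Nonempty) :
    ∑ e ∈ betweenEdges z S, z e ≤ (tightParts z S).card - 1 := by
  have hsub : (tightParts z S).biUnion Finset.sym2 ⊆ S.sym2 :=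
    biUnion_subset.2 fun P hP => sym2_mono (subset_of_mem_tightParts hP)
  have h1 := sum_sdiff (f := z) hsub
  have hdis : ((tightParts z S : Finset (Finset V)) : Set (Finset V)).PairwiseDisjoint
      Finset.sym2 := by
    intro P hP Q hQ hne
    rw [Function.onFun, disjoint_left]
    intro e heP heQ
    exact disjoint_left.1 (disjoint_tightParts hz hP hQ hne)
      (mem_sym2_iff.1 heP _ (Sym2.out_fst_mem e)) (mem_sym2_iff.1 heQ _ (Sym2.out_fst_mem e))
  have hcard : S.card = ∑ P ∈ tightParts z S, P.card := by
    conv_lhs => rw [← biUnion_tightParts hz (S := S)]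
    exact card_biUnion fun P hP Q hQ hne => disjoint_tightParts hz hP hQ hne
  rw [sum_biUnion hdis, sum_congr rfl fun P hP => (tight_of_mem_tightParts hP).2,
    sum_sub_distrib, ← Nat.cast_sum, ← hcard, sum_const, nsmul_one] at h1
  have := hz.2 S hS
  rw [betweenEdges]
  linarith

lemma card_tightParts_cross_le (hz : ForestPoint z) (e : Sym2 V) :
    ((tightParts z S).filter fun P => e ∈ crossEdges P).card ≤
      (if e ∈ crossEdges S then 1 else 0) + 2 * (if e ∈ betweenEdges z S then 1 else 0) := by
  have hdis : ∀ P ∈ (tightParts z S).filter (fun P => e ∈ crossEdges P),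
      ∀ Q ∈ (tightParts z S).filter (fun P => e ∈ crossEdges P), P ≠ Q → Disjoint P Q :=
    fun P hP Q hQ hne => disjoint_tightParts hz (mem_filter.1 hP).1 (mem_filter.1 hQ).1 hne
  by_cases hC : e ∈ betweenEdges z S
  · rw [if_pos hC]
    refine le_trans ?_ (Nat.le_add_left _ _)
    exact card_le_two_of_touch hdis fun P hP =>
      crossEdges_subset_touchEdges P (mem_filter.1 hP).2
  rw [if_neg hC, mul_zero, add_zero]
  have hsub : ∀ P ∈ (tightParts z S).filter (fun P => e ∈ crossEdges P), e ∈ crossEdges S := by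
    intro P hP
    obtain ⟨hP, heP⟩ := mem_filter.1 hP
    simp only [crossEdges, mem_filter, mem_univ, true_and] at heP ⊢
    obtain ⟨⟨u, hu, huP⟩, v, hv, hvP⟩ := heP
    refine ⟨⟨u, hu, subset_of_mem_tightParts hP huP⟩, ?_⟩
    by_contra! h
    refine hC (mem_sdiff.2 ⟨mem_sym2_iff.2 h, fun h' => ?_⟩)
    obtain ⟨Q, hQ, heQ⟩ := mem_biUnion.1 h'
    rw [mem_sym2_iff] at heQ
    have : P = Q := by
      by_contra hne
      exact disjoint_left.1 (disjoint_tightParts hz hP hQ hne) huP (heQ u hu)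
    exact hvP (this ▸ heQ v hv)
  split_ifs with hS
  · rw [card_le_one]
    intro P hP Q hQ
    by_contra hne
    have hd := hdis P hP Q hQ hne
    obtain ⟨hP, heP⟩ := mem_filter.1 hP
    obtain ⟨hQ, heQ⟩ := mem_filter.1 hQ
    have hPS := subset_of_mem_tightParts hP
    have hQS := subset_of_mem_tightParts hQ
    simp only [crossEdges, mem_filter, mem_univ, true_and] at heP heQ hS
    obtain ⟨⟨u, hu, huP⟩, -⟩ := heP
    obtain ⟨⟨v, hv, hvQ⟩, -⟩ := heQ
    obtain ⟨-, w, hw, hwS⟩ := hS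
    have huv : u ≠ v := fun h => disjoint_left.1 hd huP (h ▸ hvQ)
    rw [(Sym2.mem_and_mem_iff huv).1 ⟨hu, hv⟩, Sym2.mem_iff] at hw
    rcases hw with rfl | rfl
    · exact hwS (hPS huP)
    · exact hwS (hQS hvQ)
  · rw [Nat.le_zero, card_eq_zero, eq_empty_iff_forall_notMem]
    exact fun P hP => hS (hsub P hP)

lemma sum_cross_tightParts_le (hz : ForestPoint z) {x : Sym2 V → ℝ} (hx : ∀ e, 0 ≤ x e) :
    ∑ P ∈ tightParts z S, ∑ e ∈ crossEdges P, x e ≤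
      ∑ e ∈ crossEdges S, x e + 2 * ∑ e ∈ betweenEdges z S, x e := by
  have h1 : ∀ A : Finset (Sym2 V), ∑ e ∈ A, x e = ∑ e, (if e ∈ A then 1 else 0) * x e := by
    intro A
    simp
  simp_rw [h1]
  rw [sum_comm, mul_sum, ← sum_add_distrib]
  refine sum_le_sum fun e _ => ?_
  rw [← sum_mul, ← mul_assoc, ← add_mul]
  refine mul_le_mul_of_nonneg_right ?_ (hx e)
  rw [sum_boole]
  exact_mod_cast card_tightParts_cross_le hz e

lemma crossEdges_subset_biUnion (hz : ForestPoint z) :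
    crossEdges S ⊆ (tightParts z S).biUnion crossEdges := by
  intro e he
  simp only [crossEdges, mem_filter, mem_univ, true_and, mem_biUnion] at he ⊢
  obtain ⟨⟨u, hu, huS⟩, v, hv, hvS⟩ := he
  rw [← biUnion_tightParts hz (S := S), mem_biUnion] at huS
  obtain ⟨P, hP, huP⟩ := huS
  exact ⟨P, hP, ⟨u, hu, huP⟩, v, hv, fun h => hvS (subset_of_mem_tightParts hP h)⟩

end tightParts

lemma one_le_sum_crossEdges [Fintype V] {x : Sym2 V → ℝ} (hx : ForestPoint x)
    (ht : Tight x univ) {P : Finset V} (hP : P.Nonempty) (hne : P ≠ univ) :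
    1 ≤ ∑ e ∈ crossEdges P, x e := by
  have hsplit : ∑ e, x e = ∑ e ∈ touchEdges P, x e + ∑ e ∈ Pᶜ.sym2, x e := by
    rw [← sum_add_sum_compl (touchEdges P)]
    congr 2
    ext e
    simp [touchEdges, mem_sym2_iff]
  have h1 := hx.2 P hP
  have h2 := hx.2 Pᶜ (nonempty_iff_ne_empty.2 fun h => hne ((compl_eq_empty_iff P).1 h))
  have h3 := ht.2
  rw [sym2_univ, hsplit, touchEdges_sum, card_univ] at h3
  have h4 : (P.card : ℝ) + Pᶜ.card = Fintype.card V := by exact_mod_cast card_add_card_compl P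
  linarith
lemma sum_cross_tightParts_le_of_saturated [Fintype V] {x z : Sym2 V → ℝ} (hx : ForestPoint x)
    (hxt : Tight x univ) (hz : ForestPoint z) {η : ℝ} (hη : 2 < η) {S : Finset V}
    (hS : S.Nonempty) (hSne : S ≠ univ)
    (hsat : ∀ e ∈ S.sym2, z e < η * x e → ∃ U ⊆ S, Tight z U ∧ e ∈ U.sym2) :
    (tightParts z S).card ≤ ∑ P ∈ tightParts z S, ∑ e ∈ crossEdges P, x e ∧
      (1 - 2 / η) * ∑ P ∈ tightParts z S, ∑ e ∈ crossEdges P, x e ≤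
        ∑ e ∈ crossEdges S, x e := by
  have h1 : ((tightParts z S).card : ℝ) ≤ ∑ P ∈ tightParts z S, ∑ e ∈ crossEdges P, x e := by
    rw [← nsmul_one]
    refine card_nsmul_le_sum _ _ _ fun P hP => ?_
    refine one_le_sum_crossEdges hx hxt (tight_of_mem_tightParts hP).1 fun h => hSne ?_
    exact univ_subset_iff.1 (h ▸ subset_of_mem_tightParts hP)
  refine ⟨h1, ?_⟩
  have h2 : η * ∑ e ∈ betweenEdges z S, x e ≤ ∑ e ∈ betweenEdges z S, z e := by
    rw [mul_sum]
    refine sum_le_sum fun e he => ?_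
    obtain ⟨heS, he⟩ := mem_sdiff.1 he
    by_contra! hlt
    obtain ⟨U, hUS, hU, heU⟩ := hsat e heS hlt
    obtain ⟨P, hP, hUP⟩ := exists_tightPart hU hUS
    exact he (mem_biUnion.2 ⟨P, hP, sym2_mono hUP heU⟩)
  have h3 := sum_betweenEdges_le hz hS
  have h4 := sum_cross_tightParts_le hz hx.1 (S := S)
  set X := ∑ P ∈ tightParts z S, ∑ e ∈ crossEdges P, x e
  have h5 : ∑ e ∈ betweenEdges z S, x e ≤ X / η := by
    rw [le_div_iff₀ (by linarith)]
    linarith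
  have h6 : (1 - 2 / η) * X = X - 2 * (X / η) := by ring
  linarith

lemma fLaminar_toFinsets [Fintype V] {L : Set (Set V)} (hL : Laminar L) :
    FLaminar (insert univ (univ.filter fun S : Finset V => (S : Set V) ∈ L)) := by
  intro A hA B hB
  simp only [mem_insert, mem_filter, mem_univ, true_and] at hA hB
  rcases hA with rfl | hA
  · exact Or.inr (Or.inr (subset_univ B))
  rcases hB with rfl | hB
  · exact Or.inr (Or.inl (subset_univ A))
  rcases hL A B hA hB with h | h | h
  · exact Or.inl (disjoint_coe.1 (Set.disjoint_iff_inter_eq_empty.2 h))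
  · exact Or.inr (Or.inl (coe_subset.1 (Set.inter_eq_left.1 h)))
  · exact Or.inr (Or.inr (coe_subset.1 (Set.inter_eq_right.1 h)))

lemma mem_cutEdges [Fintype V] {G : SimpleGraph V} {S : Set V} {e : Sym2 V} :
    e ∈ cutEdges G S ↔ e ∈ G.edgeSet ∧ e ∈ crossEdges S.toFinset := by
  simp only [cutEdges, crossEdges, mem_filter, mem_univ, true_and, Set.mem_toFinset]
  refine and_congr_right fun _ => ⟨?_, ?_⟩
  · rintro ⟨u, v, rfl, hu, hv⟩
    exact ⟨⟨u, by simp, hu⟩, v, by simp, hv⟩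
  · rintro ⟨⟨u, hu, huS⟩, v, hv, hvS⟩
    have huv : u ≠ v := fun h => hvS (h ▸ huS)
    exact ⟨u, v, (Sym2.mem_and_mem_iff huv).1 ⟨hu, hv⟩, huS, hvS⟩

lemma sum_cutEdges [Fintype V] {G : SimpleGraph V} {x : Sym2 V → ℝ}
    (hx : ∀ e, e ∉ G.edgeSet → x e = 0) (S : Set V) :
    ∑ e ∈ cutEdges G S, x e = ∑ e ∈ crossEdges S.toFinset, x e := by
  refine sum_subset (fun e he => (mem_cutEdges.1 he).2) fun e he hne => hx e fun h => ?_
  exact hne (mem_cutEdges.2 ⟨h, he⟩)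

lemma crossEdges_empty [Fintype V] : crossEdges (∅ : Finset V) = ∅ := by
  simp [crossEdges]

lemma crossEdges_univ [Fintype V] : crossEdges (univ : Finset V) = ∅ := by
  simp [crossEdges]

lemma card_inter_crossEdges_le [Fintype V] {x z : Sym2 V → ℝ} (hx : ForestPoint x)
    (hxt : Tight x univ) (hz : ForestPoint z) {η : ℝ} (hη : 2 < η) {S : Finset V}
    (hsat : ∀ e ∈ S.sym2, z e < η * x e → ∃ U ⊆ S, Tight z U ∧ e ∈ U.sym2)
    {E : Finset (Sym2 V)} (hE : ∀ P ∈ tightParts z S, ((E ∩ crossEdges P).card : ℤ) ≤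
      ⌈η * ∑ e ∈ crossEdges P, x e⌉ + 4) :
    ((E ∩ crossEdges S).card : ℝ) ≤
      (1 / (1 - 2 / η)) * (2 * η + 3) * ∑ e ∈ crossEdges S, x e := by
  rcases S.eq_empty_or_nonempty with rfl | hS
  · simp [crossEdges_empty]
  by_cases hSne : S = univ
  · simp [hSne, crossEdges_univ]
  obtain ⟨h1, h2⟩ := sum_cross_tightParts_le_of_saturated hx hxt hz hη hS hSne hsat
  have h3 : ((E ∩ crossEdges S).card : ℝ) ≤
      ∑ P ∈ tightParts z S, (η * ∑ e ∈ crossEdges P, x e + 5) := by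
    have h4 : (E ∩ crossEdges S).card ≤ ∑ P ∈ tightParts z S, (E ∩ crossEdges P).card := by
      refine le_trans (card_le_card ?_) card_biUnion_le
      rw [← inter_biUnion]
      exact inter_subset_inter_left (crossEdges_subset_biUnion hz)
    refine (Nat.cast_le.2 h4).trans ?_
    rw [Nat.cast_sum]
    refine sum_le_sum fun P hP => ?_
    have h5 : ((E ∩ crossEdges P).card : ℝ) ≤ ⌈η * ∑ e ∈ crossEdges P, x e⌉ + 4 := by
      exact_mod_cast hE P hP
    have h6 := Int.ceil_lt_add_one (η * ∑ e ∈ crossEdges P, x e)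
    linarith
  rw [sum_add_distrib, ← mul_sum, sum_const, nsmul_eq_mul] at h3
  set X := ∑ P ∈ tightParts z S, ∑ e ∈ crossEdges P, x e
  have hX : 0 ≤ X := (Nat.cast_nonneg _).trans h1
  have hpos : 0 < 1 - 2 / η := by
    rw [sub_pos, div_lt_one (by linarith)]
    exact hη
  have h7 : X ≤ (∑ e ∈ crossEdges S, x e) / (1 - 2 / η) := by
    rw [le_div_iff₀ hpos, mul_comm]
    exact h2
  calc ((E ∩ crossEdges S).card : ℝ) ≤ (2 * η + 3) * X := by nlinarith
    _ ≤ (2 * η + 3) * ((∑ e ∈ crossEdges S, x e) / (1 - 2 / η)) :=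
        mul_le_mul_of_nonneg_left h7 (by linarith)
    _ = _ := by ring

/-- Thin trees for laminar families, general `η > 2`. -/
theorem laminar_thin_tree_eta [Fintype V] (G : SimpleGraph V) (hG : G.Connected)
    (L : Set (Set V)) (hL : Laminar L)
    (c : Sym2 V → ℝ) (hc : ∀ e, 0 ≤ c e)
    (x : Sym2 V → ℝ) (hx : x ∈ stPolytope G)
    (η : ℝ) (hη : 2 < η) :
    ∃ T : SimpleGraph V, T ≤ G ∧ T.IsTree ∧
      (∑ e ∈ T.edgeFinset, c e) ≤ η * ∑ e ∈ G.edgeFinset, c e * x e ∧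
      ∀ S ∈ L, ((T.edgeFinset ∩ cutEdges G S).card : ℝ) ≤
        (1 / (1 - 2 / η)) * (2 * η + 3) * ∑ e ∈ cutEdges G S, x e := by
  have := hG.nonempty
  obtain ⟨hxf, hx0, hxt⟩ := treeFace_of_mem_stPolytope hx
  replace hxt := hxt univ (mem_singleton_self _)
  have hη0 : 0 ≤ η := by linarith
  have hxw : x ≤ fun e => η * x e := fun e =>
    le_mul_of_one_le_left (hxf.1 e) (by linarith)
  have hlam := fLaminar_toFinsets hL
  set L₀ := insert univ (univ.filter fun S : Finset V => (S : Set V) ∈ L) with hL₀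
  obtain ⟨z, hz, hzt, hzw, hsat⟩ := exists_saturated hlam hxf hxt hxw
  have huniv : univ ∈ L₀.biUnion (tightParts z) := by
    obtain ⟨P, hP, hPu⟩ := exists_tightPart hzt (subset_refl univ)
    rw [univ_subset_iff] at hPu
    exact mem_biUnion.2 ⟨univ, mem_insert_self _ _, hPu ▸ hP⟩
  have hface : TreeFace G (L₀.biUnion (tightParts z)) z := by
    refine ⟨hz, fun e he => le_antisymm ?_ (hz.1 e), fun U hU => ?_⟩
    · have := hzw e
      simpa [hx0 e he] using this
    · obtain ⟨S, -, hUS⟩ := mem_biUnion.1 hU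
      exact tight_of_mem_tightParts hUS
  obtain ⟨T, hTG, hT, hTc, hTb⟩ := exists_rounded_tree (fLaminar_biUnion_tightParts hz hlam) huniv
    (fun P => ⌈η * ∑ e ∈ crossEdges P, x e⌉) c z hface fun P _ => by
      refine le_trans ?_ (Int.le_ceil _)
      rw [mul_sum]
      exact sum_le_sum fun e _ => hzw e
  refine ⟨T, hTG, hT, hTc.trans ?_, fun S hS => ?_⟩
  · have h1 : ∑ e ∈ G.edgeFinset, c e * x e = ∑ e, c e * x e := by
      refine sum_subset (subset_univ _) fun e _ he => ?_
      rw [hx0 e fun h => he (SimpleGraph.mem_edgeFinset.2 h), mul_zero]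
    rw [h1, mul_sum]
    refine sum_le_sum fun e _ => ?_
    rw [mul_left_comm]
    exact mul_le_mul_of_nonneg_left (hzw e) (hc e)
  · have hS₀ : S.toFinset ∈ L₀ := by simp [hL₀, hS]
    have hsub : T.edgeFinset ∩ cutEdges G S ⊆ T.edgeFinset ∩ crossEdges S.toFinset :=
      inter_subset_inter_left fun e he => (mem_cutEdges.1 he).2
    refine (Nat.cast_le.2 (card_le_card hsub)).trans ?_
    rw [sum_cutEdges hx0]
    exact card_inter_crossEdges_le hxf hxt hz hη (hsat _ hS₀) fun P hP =>
      hTb P (mem_biUnion.2 ⟨_, hS₀, hP⟩)
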